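/- arXiv:1307.8386 — 10 statements merged into one kernel-verified Lean document; each statement's English description precedes it below -/
import Mathlib

section
/- Suppose Δ = 4ab − c² is a nonzero square in F (i.e. Q is hyperbolic). Then the number of triples (x,y,z) ∈ F³ satisfying both z^q + z = x^(q+1) + y^(q+1) and z = a·x² + b·y² + c·x·y + d·x + e·y + f is one of the nine values q², q³−q², q³−q²+q, q³−q, q³, q³+q, q³+q²−q, q³+q², 2q³−q². -/
open Finset

section DiagonalQuadric

variable {K : Type*} [Field K] [Fintype K] [DecidableEq K]

theorem sum_comp_sq (hK : ringChar K ≠ 2) (g : K → ℤ) :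
    ∑ x, g (x ^ 2) = ∑ v, (1 + quadraticChar K v) * g v := by
  rw [← Finset.sum_fiberwise_of_maps_to (s := univ) (t := univ) (g := fun x : K => x ^ 2)
    (fun _ _ => mem_univ _)]
  refine sum_congr rfl fun v _ => ?_
  have h := quadraticChar_card_sqrts hK v
  rw [sum_congr rfl (g := fun _ => g v) (fun x hx => by rw [(mem_filter.mp hx).2]), sum_const,
    nsmul_eq_mul, add_comm 1, ← h]
  congr 3
  ext x
  simp

theorem sum_comp_quadratic (hK : ringChar K ≠ 2) {w : K} (hw : w ≠ 0) (l : K) (g : K → ℤ) :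
    ∑ x, g (w * x ^ 2 + l * x) =
      ∑ v, (1 + quadraticChar K v) * g (w * v - l ^ 2 / (4 * w)) := by
  have h2 : (2 : K) ≠ 0 := Ring.two_ne_zero hK
  have h4 : (4 : K) ≠ 0 := by
    have : (4 : K) = 2 * 2 := by norm_num
    rw [this]; exact mul_ne_zero h2 h2
  rw [← sum_comp_sq hK (fun v => g (w * v - l ^ 2 / (4 * w))),
    ← Equiv.sum_comp (Equiv.addRight (l / (2 * w))) (fun x => g (w * x ^ 2 - l ^ 2 / (4 * w)))]
  refine sum_congr rfl fun x _ => ?_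
  congr 1
  simp only [Equiv.coe_addRight]
  field_simp
  ring

theorem sum_quadraticChar_mul_quadraticChar_sub (hK : ringChar K ≠ 2) {w : K} (hw : w ≠ 0)
    (t : K) :
    ∑ v, quadraticChar K v * quadraticChar K (t - w * v) =
      quadraticChar K (-w) * (Fintype.card K * (if t = 0 then 1 else 0) - 1) := by
  by_cases ht : t = 0
  · subst ht
    have h (v : K) : quadraticChar K v * quadraticChar K (0 - w * v) =
        quadraticChar K (-w) * (if v = 0 then 0 else 1) := by
      rw [zero_sub, ← neg_mul, map_mul]
      split_ifs with hv
      · simp [hv]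
      · linear_combination quadraticChar K (-w) * quadraticChar_sq_one hv
    rw [sum_congr rfl fun v _ => h v, ← mul_sum]
    congr 1
    simp only [if_true, mul_one]
    have h1 (v : K) : (if v = 0 then (0 : ℤ) else 1) = 1 - if v = 0 then 1 else 0 := by
      split_ifs <;> rfl
    simp only [h1, sum_sub_distrib, sum_ite_eq', mem_univ, if_true]
    simp
  · have hJ := jacobiSum_nontrivial_inv (quadraticChar_ne_one hK)
    rw [(quadraticChar_isQuadratic K).inv, jacobiSum] at hJ
    rw [← Equiv.sum_comp (Equiv.mulLeft₀ (t / w) (div_ne_zero ht hw))]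
    have h (v : K) : quadraticChar K (t / w * v) * quadraticChar K (t - w * (t / w * v)) =
        quadraticChar K w * (quadraticChar K v * quadraticChar K (1 - v)) := by
      have e1 : t - w * (t / w * v) = t * (1 - v) := by field_simp
      have e2 : quadraticChar K (t / w) = quadraticChar K t * quadraticChar K w := by
        have := quadraticChar_sq_one hw
        have h3 : quadraticChar K (t / w) * quadraticChar K w = quadraticChar K t := by
          rw [← map_mul, div_mul_cancel₀ _ hw]
        linear_combination (-quadraticChar K (t / w)) * this + quadraticChar K w * h3
      rw [e1, map_mul, map_mul, e2]
      linear_combination (quadraticChar K w * quadraticChar K v * quadraticChar K (1 - v)) *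
        quadraticChar_sq_one ht
    simp only [Equiv.mulLeft₀_apply]
    rw [sum_congr rfl fun v _ => h v, ← mul_sum, hJ, if_neg ht, neg_eq_neg_one_mul w, map_mul]
    ring

/-- The number of solutions of a diagonal quadratic equation. -/
def diagCount {n : ℕ} (w l : Fin n → K) (u : K) : ℤ :=
  #{x : Fin n → K | ∑ i, (w i * x i ^ 2 + l i * x i) = u}

theorem diagCount_succ {n : ℕ} (w l : Fin (n + 1) → K) (u : K) :
    diagCount w l u =
      ∑ x, diagCount (fun i => w i.succ) (fun i => l i.succ) (u - (w 0 * x ^ 2 + l 0 * x)) := by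
  simp only [diagCount, card_filter, Nat.cast_sum]
  rw [← (Fin.consEquiv (fun _ => K)).sum_comp, Fintype.sum_prod_type]
  refine sum_congr rfl fun x _ => sum_congr rfl fun y _ => ?_
  simp [Fin.sum_univ_succ, Fin.consEquiv, eq_sub_iff_add_eq']

/-- Either all fibres of a diagonal quadratic polynomial in `n` variables have the same size, or
their sizes are given by the parity of the rank, a sign and a translation. -/
theorem diagCount_eq (hK : ringChar K ≠ 2) {n : ℕ} (w l : Fin n → K) :
    (∀ u, diagCount w l u * Fintype.card K = Fintype.card K ^ n) ∨
    ∃ (u₀ : K) (ε : ℤ) (k : ℕ), ε ^ 2 = 1 ∧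
      ((#{i | w i ≠ 0} = 2 * k ∧ ∀ u, diagCount w l u * Fintype.card K ^ (k + 1) =
          Fintype.card K ^ n * (Fintype.card K ^ k +
            ε * (Fintype.card K * (if u = u₀ then 1 else 0) - 1))) ∨
       (#{i | w i ≠ 0} = 2 * k + 1 ∧ ∀ u, diagCount w l u * Fintype.card K ^ (k + 1) =
          Fintype.card K ^ n * (Fintype.card K ^ k + ε * quadraticChar K (u - u₀)))) := by
  have hsum1 : ∑ v : K, (1 + quadraticChar K v) = Fintype.card K := by
    rw [sum_add_distrib, quadraticChar_sum_zero hK]; simp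
  have hsum0 : ∑ v : K, quadraticChar K v = 0 := quadraticChar_sum_zero hK
  have hq : (Fintype.card K : ℤ) ≠ 0 := by exact_mod_cast Fintype.card_ne_zero
  induction n with
  | zero =>
    refine Or.inr ⟨0, 1, 0, by norm_num, Or.inl ⟨by simp, fun u => ?_⟩⟩
    simp only [diagCount]
    by_cases hu : u = 0
    · simp [hu]
    · simp [hu, Ne.symm hu]
  | succ n ih =>
    have hrec := diagCount_succ w l
    have hcard : #{i | w i ≠ 0} = (if w 0 ≠ 0 then 1 else 0) + #{i : Fin n | w i.succ ≠ 0} := by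
      simp only [card_filter, Fin.sum_univ_succ]
    specialize ih (fun i => w i.succ) (fun i => l i.succ)
    generalize diagCount (fun i => w i.succ) (fun i => l i.succ) = N at hrec ih
    generalize #{i : Fin n | w i.succ ≠ 0} = r at hcard ih
    have hconst (c : ℤ) : ∑ _v : K, c = Fintype.card K * c := by simp
    set q : ℤ := ((Fintype.card K : ℕ) : ℤ)
    by_cases hw : w 0 = 0
    · simp only [hw, ne_eq, not_true_eq_false, if_false, zero_add, zero_mul] at hcard hrec
      rw [hcard]
      by_cases hl : l 0 = 0
      · simp only [hl, zero_mul, sub_zero, hconst] at hrec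
        obtain h | ⟨u₀, ε, k, hε, ⟨hr, h⟩ | ⟨hr, h⟩⟩ := ih
        · refine Or.inl fun u => ?_
          rw [hrec]
          linear_combination q * h u
        · refine Or.inr ⟨u₀, ε, k, hε, Or.inl ⟨hr, fun u => ?_⟩⟩
          rw [hrec]
          linear_combination q * h u
        · refine Or.inr ⟨u₀, ε, k, hε, Or.inr ⟨hr, fun u => ?_⟩⟩
          rw [hrec]
          linear_combination q * h u
      · have hrec' (u : K) : diagCount w l u = ∑ v, N v := by
          rw [hrec, ← Equiv.sum_comp ((Equiv.mulLeft₀ (l 0) hl).trans (Equiv.subLeft u)) N]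
          rfl
        refine Or.inl fun u => ?_
        rw [hrec']
        obtain h | ⟨u₀, ε, k, hε, ⟨hr, h⟩ | ⟨hr, h⟩⟩ := ih
        · rw [sum_mul, sum_congr rfl fun v _ => h v, hconst]
          ring
        · have : (∑ v, N v) * q ^ (k + 1) = q ^ n * (q * q ^ k) := by
            rw [sum_mul, sum_congr rfl fun v _ => h v, ← mul_sum, sum_add_distrib, ← mul_sum,
              sum_sub_distrib, ← mul_sum, sum_ite_eq', hconst, hconst]
            simp
          refine mul_right_cancel₀ (pow_ne_zero k hq) ?_
          linear_combination this
        · have : (∑ v, N v) * q ^ (k + 1) = q ^ n * (q * q ^ k) := by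
            rw [sum_mul, sum_congr rfl fun v _ => h v, ← mul_sum, sum_add_distrib, ← mul_sum,
              hconst,
              show ∑ v, quadraticChar K (v - u₀) = 0 from
                (Equiv.sum_comp (Equiv.subRight u₀) (quadraticChar K)).trans hsum0]
            simp
          refine mul_right_cancel₀ (pow_ne_zero k hq) ?_
          linear_combination this
    · simp only [ne_eq, hw, not_false_eq_true, if_true] at hcard
      set s := l 0 ^ 2 / (4 * w 0)
      have hrec' (u : K) : diagCount w l u =
          ∑ v, (1 + quadraticChar K v) * N (u - (w 0 * v - s)) := by
        rw [hrec, sum_comp_quadratic hK hw (l 0) (fun x => N (u - x))]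
      rw [hcard]
      have hη : quadraticChar K (w 0) ^ 2 = 1 := quadraticChar_sq_one hw
      obtain h | ⟨u₀, ε, k, hε, ⟨hr, h⟩ | ⟨hr, h⟩⟩ := ih
      · refine Or.inl fun u => ?_
        rw [hrec', sum_mul, sum_congr rfl fun v _ => by rw [mul_assoc, h], ← sum_mul, hsum1]
        ring
      · refine Or.inr ⟨u₀ - s, ε * quadraticChar K (w 0), k, by rw [mul_pow, hε, hη, one_mul],
          Or.inr ⟨by omega, fun u => ?_⟩⟩
        have hA : ∑ v, (1 + quadraticChar K v) * (if u - (w 0 * v - s) = u₀ then 1 else 0) =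
            1 + quadraticChar K (w 0) * quadraticChar K (u - (u₀ - s)) := by
          have e (v : K) : u - (w 0 * v - s) = u₀ ↔ v = w 0 * (u - (u₀ - s)) / w 0 ^ 2 := by
            rw [eq_div_iff (pow_ne_zero 2 hw)]
            constructor
            · intro h
              linear_combination (-w 0) * h
            · intro h
              refine mul_left_cancel₀ hw ?_
              linear_combination -h
          simp only [e, mul_ite, mul_one, mul_zero, sum_ite_eq', mem_univ, if_true]
          congr 1
          rw [← map_mul]
          have h3 : quadraticChar K (w 0 * (u - (u₀ - s)) / w 0 ^ 2) *
              quadraticChar K (w 0 ^ 2) = quadraticChar K (w 0 * (u - (u₀ - s))) := by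
            rw [← map_mul, div_mul_cancel₀ _ (pow_ne_zero 2 hw)]
          rwa [quadraticChar_sq_one' hw, mul_one] at h3
        rw [hrec', sum_mul, sum_congr rfl fun v _ => show _ = q ^ n * (q ^ k - ε) *
          (1 + quadraticChar K v) + q ^ n * ε * q * ((1 + quadraticChar K v) *
            (if u - (w 0 * v - s) = u₀ then 1 else 0)) by rw [mul_assoc, h]; ring,
          sum_add_distrib, ← mul_sum, ← mul_sum, hA, hsum1]
        ring
      · refine Or.inr ⟨u₀ - s, ε * quadraticChar K (-w 0), k + 1,
          by rw [mul_pow, hε, quadraticChar_sq_one (neg_ne_zero.mpr hw), one_mul],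
          Or.inl ⟨by omega, fun u => ?_⟩⟩
        have hB : ∑ v, quadraticChar K (u - (w 0 * v - s) - u₀) = 0 := by
          rw [← hsum0, ← Equiv.sum_comp ((Equiv.mulLeft₀ (w 0) hw).trans
            (Equiv.subLeft (u + s - u₀))) (quadraticChar K)]
          refine sum_congr rfl fun v _ => congrArg _ ?_
          simp only [Equiv.trans_apply, Equiv.mulLeft₀_apply, Equiv.subLeft_apply]
          ring
        have hC := sum_quadraticChar_mul_quadraticChar_sub hK hw (u - (u₀ - s))
        rw [sum_congr rfl fun v _ => show _ = quadraticChar K v *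
          quadraticChar K (u - (w 0 * v - s) - u₀) by congr 2; ring] at hC
        simp only [sub_eq_zero] at hC
        rw [pow_succ, ← mul_assoc, hrec', sum_mul,
          sum_congr rfl fun v _ => show _ = q ^ n * q ^ k * (1 + quadraticChar K v) +
            q ^ n * ε * (quadraticChar K (u - (w 0 * v - s) - u₀) +
              quadraticChar K v * quadraticChar K (u - (w 0 * v - s) - u₀)) by
            rw [mul_assoc, h]; ring,
          sum_add_distrib, ← mul_sum, ← mul_sum, hsum1, sum_add_distrib, hB, hC]
        ring

end DiagonalQuadric

section QuadraticSpace

variable {K V : Type*} [Field K] [Fintype K] [AddCommGroup V] [Module K V] [Finite V]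

open QuadraticMap

/-- A diagonalization of a form on an `(n + 2)`-dimensional space whose radical has at most `q ^ n`
elements has at least two nonzero weights. -/
theorem two_le_card_weights [DecidableEq K] {n : ℕ} {Q : QuadraticForm K V}
    (hV : Module.finrank K V = n + 2)
    (hQ : Nat.card {v : V // ∀ u, polar Q v u = 0} ≤ Fintype.card K ^ n)
    {w : Fin (n + 2) → K} (e : V ≃ₗ[K] (Fin (n + 2) → K))
    (he : ∀ v, Q v = ∑ i, w i * e v i ^ 2) : 2 ≤ #{i | w i ≠ 0} := by
  by_contra! hlt
  obtain ⟨i, hi⟩ := card_le_one_iff_subset_singleton.mp (Nat.lt_succ_iff.mp hlt)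
  have hw (j) (hj : j ≠ i) : w j = 0 := by
    by_contra h
    exact hj (mem_singleton.mp (hi (mem_filter.mpr ⟨mem_univ _, h⟩)))
  have he' (v : V) : Q v = w i * e v i ^ 2 := by
    rw [he, Finset.sum_eq_single i (fun j _ hj => by rw [hw j hj, zero_mul]) (by simp)]
  let φ : V →ₗ[K] K := LinearMap.proj i ∘ₗ e.toLinearMap
  have hφ (v : V) : φ v = e v i := rfl
  have hker : Nat.card (LinearMap.ker φ) ≤ Nat.card {v : V // ∀ u, polar Q v u = 0} := by
    refine Nat.card_le_card_of_injective (fun v => ⟨v.1, fun u => ?_⟩) fun v v' h => ?_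
    · have h0 : e v.1 i = 0 := v.2
      simp [polar, he', h0]
    · exact Subtype.ext (congrArg (fun x => x.1) h)
  have hrk := φ.finrank_range_add_finrank_ker
  have hr : Module.finrank K (LinearMap.range φ) ≤ 1 := by
    simpa using (LinearMap.range φ).finrank_le
  have hc := Module.natCard_eq_pow_finrank (K := K) (V := LinearMap.ker φ)
  rw [Nat.card_eq_fintype_card (α := K)] at hc
  have : Fintype.card K ^ (n + 1) ≤ Fintype.card K ^ Module.finrank K (LinearMap.ker φ) :=
    Nat.pow_le_pow_right Fintype.card_pos (by omega)
  have h2 : Fintype.card K ^ n < Fintype.card K ^ (n + 1) :=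
    Nat.pow_lt_pow_right Fintype.one_lt_card (by omega)
  omega

/-- The sizes of affine quadrics in dimension four whose quadratic part has rank at least two. -/
theorem card_quadric_four (hK : ringChar K ≠ 2) {Q : QuadraticForm K V}
    (hV : Module.finrank K V = 4) {q : ℕ} (hq : Fintype.card K = q)
    (hQ : Nat.card {v : V // ∀ u, polar Q v u = 0} ≤ q ^ 2) (L : V →ₗ[K] K) (t : K) :
    Nat.card {v : V // Q v + L v + t = 0} ∈
      ({q ^ 2, q ^ 3 - q ^ 2, q ^ 3 - q ^ 2 + q, q ^ 3 - q, q ^ 3, q ^ 3 + q,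
        q ^ 3 + q ^ 2 - q, q ^ 3 + q ^ 2, 2 * q ^ 3 - q ^ 2} : Set ℕ) := by
  let _ : DecidableEq K := Classical.decEq K
  have : Invertible (2 : K) := invertibleOfNonzero (Ring.two_ne_zero hK)
  have : FiniteDimensional K V := Module.finite_of_finrank_eq_succ hV
  obtain ⟨w, ⟨E⟩⟩ := QuadraticForm.equivalent_weightedSumSquares Q
  revert w
  rw [hV]
  intro w E
  let e : V ≃ₗ[K] (Fin 4 → K) := E.toLinearEquiv
  have he (v : V) : Q v = ∑ i, w i * e v i ^ 2 := by
    rw [← E.map_app v, weightedSumSquares_apply]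
    exact sum_congr rfl fun i _ => by rw [smul_eq_mul, pow_two]; rfl
  have hr := two_le_card_weights (n := 2) hV (hq ▸ hQ) e he
  let l : Fin 4 → K := fun i => L (e.symm fun j => if i = j then 1 else 0)
  have hl (v : V) : L v = ∑ i, l i * e v i := by
    have := LinearMap.pi_apply_eq_sum_univ (L ∘ₗ e.symm.toLinearMap) (e v)
    simpa [mul_comm] using this
  have hN : (Nat.card {v : V // Q v + L v + t = 0} : ℤ) = diagCount w l (-t) := by
    rw [diagCount, ← Fintype.card_subtype, ← Nat.card_eq_fintype_card]
    refine congrArg _ (Nat.card_congr (e.toEquiv.subtypeEquiv fun v => ?_))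
    rw [he, hl, ← sum_add_distrib, eq_neg_iff_add_eq_zero]
    rfl
  have hr4 : #{i | w i ≠ 0} ≤ 4 := card_le_univ _
  have hq0 : (q : ℤ) ≠ 0 := by rw [← hq]; exact_mod_cast Fintype.card_ne_zero
  have hq1 : q ≤ q ^ 2 := Nat.le_self_pow two_ne_zero q
  have hq2 : q ^ 2 ≤ q ^ 3 := Nat.pow_le_pow_right (by omega) (by norm_num)
  have main := diagCount_eq hK w l
  rw [hq] at main
  generalize Nat.card {v : V // Q v + L v + t = 0} = N at *
  simp only [Set.mem_insert_iff, Set.mem_singleton_iff]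
  zify [hq1, hq2, hq1.trans hq2, show q ≤ q ^ 3 + q ^ 2 by omega, show q ^ 2 ≤ 2 * q ^ 3 by omega]
  rw [hN]
  obtain h | ⟨u₀, ε, k, hε, ⟨hk, h⟩ | ⟨hk, h⟩⟩ := main
  · have : diagCount w l (-t) = q ^ 3 := mul_right_cancel₀ hq0 (by linear_combination h (-t))
    tauto
  · have hk2 := hr.trans_eq hk
    have hk4 := hk.symm.trans_le hr4
    specialize h (-t)
    generalize diagCount w l (-t) = D at h
    obtain rfl | rfl : k = 1 ∨ k = 2 := by omega
    · have : D = q ^ 3 + ε * q ^ 2 * (q * (if -t = u₀ then 1 else 0) - 1) :=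
        mul_right_cancel₀ (pow_ne_zero 2 hq0) (by linear_combination h)
      obtain rfl | rfl := sq_eq_one_iff.mp hε <;> split_ifs at this <;>
        ring_nf at this ⊢ <;> tauto
    · have : D = q ^ 3 + ε * q * (q * (if -t = u₀ then 1 else 0) - 1) :=
        mul_right_cancel₀ (pow_ne_zero 3 hq0) (by linear_combination h)
      obtain rfl | rfl := sq_eq_one_iff.mp hε <;> split_ifs at this <;>
        ring_nf at this ⊢ <;> tauto
  · have hk2 := hr.trans_eq hk
    have hk4 := hk.symm.trans_le hr4
    specialize h (-t)
    generalize diagCount w l (-t) = D at h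
    obtain rfl : k = 1 := by omega
    have : D = q ^ 3 + ε * q ^ 2 * quadraticChar K (-t - u₀) :=
      mul_right_cancel₀ (pow_ne_zero 2 hq0) (by linear_combination h)
    obtain h0 | h0 | h0 := quadraticChar_isQuadratic K (-t - u₀) <;> rw [h0] at this <;>
    obtain rfl | rfl := sq_eq_one_iff.mp hε <;> ring_nf at this ⊢ <;> tauto

end QuadraticSpace

section QuadraticExtension

variable {F : Type*} [Field F] [Fintype F] {q : ℕ}

theorem card_pow_eq_mul_le (hq : 1 < q) (m : F) : Nat.card {x : F // x ^ q = m * x} ≤ q := by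
  classical
  open Polynomial in
  have hdeg : (X ^ q - C m * X : F[X]).natDegree = q := by
    rw [natDegree_sub_eq_left_of_natDegree_lt]
    · exact natDegree_X_pow q
    · rw [natDegree_X_pow]
      exact (natDegree_C_mul_le m X |>.trans natDegree_X_le).trans_lt hq
  have h0 : (Polynomial.X ^ q - Polynomial.C m * Polynomial.X : Polynomial F) ≠ 0 := by
    rintro h
    rw [h, Polynomial.natDegree_zero] at hdeg
    omega
  rw [Nat.card_eq_fintype_card, Fintype.card_subtype]
  refine le_trans (card_le_card (t := (Polynomial.X ^ q - Polynomial.C m * Polynomial.X :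
    Polynomial F).roots.toFinset) fun x hx => ?_) ((Multiset.toFinset_card_le _).trans
      ((Polynomial.card_roots' _).trans hdeg.le))
  rw [mem_filter] at hx
  simp [h0, hx.2]

theorem card_semilinear_fixed_le (hq : 1 < q) (hF : Fintype.card F = q ^ 2) (a b c : F) :
    Nat.card {v : F × F // v.1 ^ q = 2 * a * v.1 + c * v.2 ∧
      v.2 ^ q = 2 * b * v.2 + c * v.1} ≤ q ^ 2 := by
  by_cases hc : c = 0
  · subst hc
    refine (Nat.card_le_card_of_injective (β := {x : F // x ^ q = 2 * a * x} ×
      {x : F // x ^ q = 2 * b * x}) (fun v => (⟨v.1.1, by simpa using v.2.1⟩,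
        ⟨v.1.2, by simpa using v.2.2⟩)) ?_).trans ?_
    · intro v v' h
      simp only [Prod.mk.injEq, Subtype.mk.injEq] at h
      exact Subtype.ext (Prod.ext h.1 h.2)
    · rw [Nat.card_prod, pow_two]
      exact Nat.mul_le_mul (card_pow_eq_mul_le hq _) (card_pow_eq_mul_le hq _)
  · rw [← hF, ← Nat.card_eq_fintype_card]
    refine Nat.card_le_card_of_injective (fun v => v.1.1) fun v v' h => ?_
    refine Subtype.ext (Prod.ext h ?_)
    replace h : v.1.1 = v'.1.1 := h
    refine mul_left_cancel₀ hc ?_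
    have h1 := v.2.1
    have h2 := v'.2.1
    rw [← h] at h2
    linear_combination h2 - h1

/-- A field with `q ^ 2` elements on which `x ↦ x ^ q` is additive has a subfield with `q` elements,
fixed by `x ↦ x ^ q`, and a trace map `x ↦ x + x ^ q` to it. -/
theorem exists_subfield_trace (hq : 1 < q) (hF : Fintype.card F = q ^ 2)
    (hadd : ∀ x y : F, (x + y) ^ q = x ^ q + y ^ q) :
    ∃ (K : Subfield F) (T : F →ₗ[K] K), Nat.card K = q ∧ (∀ x : K, (x : F) ^ q = x) ∧
      (∀ x, (T x : F) = x + x ^ q) ∧ Module.finrank K F = 2 := by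
  have hqq (x : F) : (x ^ q) ^ q = x := by rw [← pow_mul, ← pow_two, ← hF, FiniteField.pow_card]
  let σ : F →+* F :=
    { toFun := fun x => x ^ q
      map_one' := one_pow q
      map_zero' := zero_pow (by omega)
      map_add' := hadd
      map_mul' := fun x y => mul_pow x y q }
  let K := σ.eqLocusField (RingHom.id F)
  have hK (x : F) : x ∈ K ↔ x ^ q = x := Iff.rfl
  let T : F →ₗ[K] K :=
    { toFun := fun x => ⟨x + x ^ q, by rw [hK, hadd, hqq, add_comm]⟩
      map_add' := fun x y => Subtype.ext (by
        simp only [hadd, Subfield.coe_add]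
        ring)
      map_smul' := fun m x => Subtype.ext (by
        simp only [Subfield.smul_def, smul_eq_mul, mul_pow, (hK m).mp m.2, RingHom.id_apply,
          Subfield.coe_mul]
        ring) }
  have hT (x : F) : (T x : F) = x + x ^ q := rfl
  have hle : Nat.card K ≤ q := by
    have := card_pow_eq_mul_le hq (1 : F)
    simp only [one_mul] at this
    exact this
  have hker : Nat.card (LinearMap.ker T) ≤ q := by
    refine le_trans (Nat.card_le_card_of_injective (fun x : LinearMap.ker T => ⟨x.1, ?h⟩) ?_)
      (card_pow_eq_mul_le hq (-1 : F))
    case h =>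
      have h : (T x.1 : F) = 0 := congrArg Subtype.val (LinearMap.mem_ker.mp x.2)
      rw [hT] at h
      linear_combination h
    exact fun x y h => Subtype.ext (congrArg (fun z => z.1) h)
  have hprod : q ^ 2 = Nat.card (LinearMap.ker T) * Nat.card (LinearMap.range T) := by
    rw [← hF, ← Nat.card_eq_fintype_card,
      Submodule.card_eq_card_quotient_mul_card (LinearMap.ker T),
      Nat.card_congr T.quotKerEquivRange.toEquiv]
  have hrange : Nat.card (LinearMap.range T) ≤ Nat.card K :=
    Nat.card_le_card_of_injective _ Subtype.val_injective
  have hcard : Nat.card K = q := by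
    refine le_antisymm hle ?_
    have : q * q ≤ q * Nat.card K := by
      rw [← pow_two, hprod]
      exact Nat.mul_le_mul hker hrange
    exact Nat.le_of_mul_le_mul_left this (by omega)
  refine ⟨K, T, hcard, fun x => x.2, hT, ?_⟩
  have := Module.natCard_eq_pow_finrank (K := K) (V := F)
  rw [hcard, Nat.card_eq_fintype_card, hF] at this
  exact (Nat.pow_right_injective hq this).symm

end QuadraticExtension

theorem affine_intersection_sizes_hyperbolic
    (q : ℕ) (hq : ∃ p n : ℕ, p.Prime ∧ Odd p ∧ 0 < n ∧ q = p ^ n)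
    (F : Type) [Field F] [Fintype F] (hF : Fintype.card F = q ^ 2)
    (a b c d e f : F)
    (hΔsq : IsSquare (4 * a * b - c ^ 2)) (hΔne : 4 * a * b - c ^ 2 ≠ 0) :
    Nat.card {v : F × F × F //
        v.2.2 ^ q + v.2.2 = v.1 ^ (q + 1) + v.2.1 ^ (q + 1) ∧
        v.2.2 = a * v.1 ^ 2 + b * v.2.1 ^ 2 + c * v.1 * v.2.1 +
          d * v.1 + e * v.2.1 + f} ∈
      ({q ^ 2, q ^ 3 - q ^ 2, q ^ 3 - q ^ 2 + q, q ^ 3 - q, q ^ 3, q ^ 3 + q,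
        q ^ 3 + q ^ 2 - q, q ^ 3 + q ^ 2, 2 * q ^ 3 - q ^ 2} : Set ℕ) := by
  obtain ⟨p, n, hp, hpodd, hn, hqp⟩ := hq
  have := Fact.mk hp
  have hq1 : 1 < q := hqp ▸ Nat.one_lt_pow hn.ne' hp.one_lt
  have : CharP F p := charP_of_card_eq_prime_pow (f := n * 2) (by rw [hF, hqp, pow_mul])
  have hp2 : p ≠ 2 := by rintro rfl; exact absurd hpodd (by decide)
  have h2 : (2 : F) ≠ 0 := Ring.two_ne_zero (by rwa [ringChar.eq F p])
  have hadd (x y : F) : (x + y) ^ q = x ^ q + y ^ q := by rw [hqp]; exact add_pow_char_pow ..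
  obtain ⟨K, T, hK, hfix, hT, hrank⟩ := exists_subfield_trace hq1 hF hadd
  have hqq (x : F) : (x ^ q) ^ q = x := by rw [← pow_mul, ← pow_two, ← hF, FiniteField.pow_card]
  have htwo : (2 : F) ^ q = 2 := by rw [← one_add_one_eq_two, hadd, one_pow]
  have hchar : ringChar K ≠ 2 := by
    have : CharP K p := (algebraMap K F).charP (algebraMap K F).injective p
    rwa [ringChar.eq K p]
  let B : LinearMap.BilinForm K (F × F) := LinearMap.mk₂ K
    (fun v u => T (a * v.1 * u.1 + b * v.2 * u.2 + c * v.1 * u.2 -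
      (v.1 * u.1 ^ q + v.2 * u.2 ^ q) / 2))
    (fun v v' u => by rw [← map_add]; congr 1; simp only [Prod.fst_add, Prod.snd_add]; ring)
    (fun m v u => by
      rw [← map_smul]; congr 1
      simp only [Prod.smul_fst, Prod.smul_snd, Subfield.smul_def, smul_eq_mul]; ring)
    (fun v u u' => by
      rw [← map_add]; congr 1; simp only [Prod.fst_add, Prod.snd_add, hadd]; ring)
    (fun m v u => by
      rw [← map_smul]; congr 1
      simp only [Prod.smul_fst, Prod.smul_snd, Subfield.smul_def, smul_eq_mul, mul_pow, hfix]
      ring)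
  let Q : QuadraticForm K (F × F) := LinearMap.BilinMap.toQuadraticMap B
  have hQ (v : F × F) : Q v = T (a * v.1 * v.1 + b * v.2 * v.2 + c * v.1 * v.2 -
      (v.1 * v.1 ^ q + v.2 * v.2 ^ q) / 2) := rfl
  have hB (v u : F × F) : B v u = T (a * v.1 * u.1 + b * v.2 * u.2 + c * v.1 * u.2 -
      (v.1 * u.1 ^ q + v.2 * u.2 ^ q) / 2) := rfl
  have hTconj (x : F) : T (x ^ q) = T x := Subtype.ext (by rw [hT, hT, hqq, add_comm])
  have hpolar (v u : F × F) : QuadraticMap.polar Q v u =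
      T (u.1 * (2 * a * v.1 + c * v.2 - v.1 ^ q) + u.2 * (2 * b * v.2 + c * v.1 - v.2 ^ q)) := by
    have hhalf (x y : F) : T (x * y ^ q / 2) = T (y * x ^ q / 2) := by
      rw [← hTconj, div_pow, mul_pow, hqq, htwo, mul_comm]
    have : NeZero (2 : F) := ⟨h2⟩
    have hN (x y : F) : T (x * y ^ q / 2 + y * x ^ q / 2) = T (y * x ^ q) := by
      rw [map_add, hhalf, ← map_add, add_halves]
    rw [LinearMap.BilinMap.polar_toQuadraticMap, hB, hB, ← map_add]
    rw [show a * v.1 * u.1 + b * v.2 * u.2 + c * v.1 * u.2 - (v.1 * u.1 ^ q + v.2 * u.2 ^ q) / 2 +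
      (a * u.1 * v.1 + b * u.2 * v.2 + c * u.1 * v.2 - (u.1 * v.1 ^ q + u.2 * v.2 ^ q) / 2) =
      (2 * a * v.1 * u.1 + 2 * b * v.2 * u.2 + c * v.1 * u.2 + c * u.1 * v.2) -
      (v.1 * u.1 ^ q / 2 + u.1 * v.1 ^ q / 2) - (v.2 * u.2 ^ q / 2 + u.2 * v.2 ^ q / 2) by ring,
      map_sub, map_sub, hN, hN, ← map_sub, ← map_sub]
    congr 1
    ring
  have hTnd (x : F) (h : ∀ u, T (u * x) = 0) : x = 0 := by
    by_contra hx
    have hle := card_pow_eq_mul_le hq1 (-1 : F)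
    have : Nat.card F ≤ Nat.card {x : F // x ^ q = -1 * x} := by
      refine Nat.card_le_card_of_injective (fun y => ⟨y, ?_⟩) fun y y' h => congrArg Subtype.val h
      have h0 : (T (y / x * x) : F) = 0 := congrArg Subtype.val (h (y / x))
      rw [div_mul_cancel₀ _ hx, hT] at h0
      linear_combination h0
    rw [Nat.card_eq_fintype_card, hF, pow_two] at this
    have := Nat.mul_lt_mul_of_lt_of_le hq1 (le_refl q) (by omega)
    omega
  have hrad : Nat.card {v : F × F // ∀ u, QuadraticMap.polar Q v u = 0} ≤ q ^ 2 := by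
    refine le_trans (Nat.card_le_card_of_injective
      (fun v : {v : F × F // ∀ u, QuadraticMap.polar Q v u = 0} => ⟨v.1, ?h₁, ?h₂⟩) ?_)
      (card_semilinear_fixed_le hq1 hF a b c)
    case h₁ =>
      refine (sub_eq_zero.mp (hTnd _ fun u => ?_)).symm
      simpa [hpolar] using v.2 (u, 0)
    case h₂ =>
      refine (sub_eq_zero.mp (hTnd _ fun u => ?_)).symm
      simpa [hpolar] using v.2 (0, u)
    exact fun x y h => Subtype.ext (congrArg (fun z => z.1) h)
  let L : F × F →ₗ[K] K := T ∘ₗ ((LinearMap.mulLeft K d).coprod (LinearMap.mulLeft K e))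
  have hL (v : F × F) : L v = T (d * v.1 + e * v.2) := rfl
  have hV : Module.finrank K (F × F) = 4 := by
    rw [Module.finrank_prod, hrank]
  have := Fintype.ofFinite K
  have key := card_quadric_four hchar hV (Nat.card_eq_fintype_card.symm.trans hK) hrad L (T f)
  convert key using 1
  have hcond (x y : F) : Q (x, y) + L (x, y) + T f = 0 ↔
      (a * x ^ 2 + b * y ^ 2 + c * x * y + d * x + e * y + f) ^ q +
        (a * x ^ 2 + b * y ^ 2 + c * x * y + d * x + e * y + f) = x ^ (q + 1) + y ^ (q + 1) := by
    have hnorm : (T ((x * x ^ q + y * y ^ q) / 2) : F) = x ^ (q + 1) + y ^ (q + 1) := by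
      rw [hT, div_pow, hadd, mul_pow, mul_pow, hqq, hqq, htwo]
      field_simp
      ring
    have hsum : Q (x, y) + L (x, y) + T f =
        T (a * x ^ 2 + b * y ^ 2 + c * x * y + d * x + e * y + f) -
          T ((x * x ^ q + y * y ^ q) / 2) := by
      rw [hQ, hL, ← map_add, ← map_add, ← map_sub]
      congr 1
      ring
    rw [hsum, sub_eq_zero, ← Subtype.coe_inj, hnorm, hT, add_comm]
  exact Nat.card_congr
    { toFun := fun v => ⟨(v.1.1, v.1.2.1), (hcond _ _).mpr (by rw [← v.2.2]; exact v.2.1)⟩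
      invFun := fun v => ⟨(v.1.1, v.1.2, a * v.1.1 ^ 2 + b * v.1.2 ^ 2 + c * v.1.1 * v.1.2 +
          d * v.1.1 + e * v.1.2 + f), (hcond _ _).mp v.2, rfl⟩
      left_inv := fun v => Subtype.ext (Prod.ext rfl (Prod.ext rfl v.2.2.symm))
      right_inv := fun v => rfl }
end

section
/- The determinant of A∞ equals ε⁴ · ((c² − 4ab)^(q+1) − 4·a^(q+1) − 4·b^(q+1) − 2·c^(q+1) + 1). (In particular, modulo nonzero squares of GF(q), det A∞ is (c²−4ab)^(q+1) − 4a^(q+1) − 4b^(q+1) − 2c^(q+1) + 1.) -/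
/-- The Gram matrix `A∞` of the quadric at infinity `Ξ∞`. -/
def Ainf (q : ℕ) {F : Type} [Field F] (ε a b c : F) : Matrix (Fin 4) (Fin 4) F :=
  !![a + a ^ q - 1, ε * (a - a ^ q), (c + c ^ q) / 2, ε * (c - c ^ q) / 2;
     ε * (a - a ^ q), (a + a ^ q + 1) * ε ^ 2, ε * (c - c ^ q) / 2, ε ^ 2 * (c + c ^ q) / 2;
     (c + c ^ q) / 2, ε * (c - c ^ q) / 2, b + b ^ q - 1, ε * (b - b ^ q);
     ε * (c - c ^ q) / 2, ε ^ 2 * (c + c ^ q) / 2, ε * (b - b ^ q), (b + b ^ q + 1) * ε ^ 2]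

theorem det_Ainf
    (q : ℕ) (hq : ∃ p n : ℕ, p.Prime ∧ Odd p ∧ 0 < n ∧ q = p ^ n)
    (F : Type) [Field F] [Fintype F] (hF : Fintype.card F = q ^ 2)
    (ε : F) (hε0 : ε ≠ 0) (hε : ε ^ q = -ε) (a b c : F) :
    (Ainf q ε a b c).det =
      ε ^ 4 * ((c ^ 2 - 4 * a * b) ^ (q + 1) - 4 * a ^ (q + 1) - 4 * b ^ (q + 1)
        - 2 * c ^ (q + 1) + 1) := by
  obtain ⟨p, n, hp, hodd, -, rfl⟩ := hq
  have : Fact p.Prime := ⟨hp⟩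
  have hchar : CharP F p := charP_of_card_eq_prime_pow (hF.trans (pow_mul p n 2).symm)
  have h2 : (2 : F) ≠ 0 := Ring.two_ne_zero (by
    rw [ringChar.eq F p]
    rintro rfl
    exact absurd hodd (by decide))
  have hfrob : (c ^ 2 - 4 * a * b) ^ p ^ n =
      (c ^ p ^ n) ^ 2 - 4 * a ^ p ^ n * b ^ p ^ n := by
    simp only [← iterateFrobenius_def, map_sub, map_mul, map_pow, map_ofNat]
  simp only [pow_succ _ (p ^ n), hfrob, Ainf]
  generalize a ^ p ^ n = A
  generalize b ^ p ^ n = B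
  generalize c ^ p ^ n = C
  simp only [Matrix.det_succ_row_zero, Fin.sum_univ_succ, Matrix.submatrix_apply, Fin.succAbove,
    Matrix.det_unique]
  simp
  field_simp
  ring
end

section
/- For all a,b,c ∈ F the matrix A∞ has rank at least 2. -/
/-- If compressing a matrix `A` to `n × n` yields a nonzero scalar matrix, then `A` has rank at
least `n`. -/
lemma Matrix.le_rank_of_mul_mul_eq_smul_one {K m l n : Type*} [Field K] [Fintype m] [Fintype l]
    [Fintype n] [DecidableEq n] (A : Matrix m l K) (U : Matrix n m K) (V : Matrix l n K)
    {r : K} (hr : r ≠ 0) (h : U * A * V = r • (1 : Matrix n n K)) :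
    Fintype.card n ≤ A.rank := by
  have h1 : ((r⁻¹ • U) * A) * V = 1 := by
    rw [Matrix.smul_mul, Matrix.smul_mul, h, smul_smul, inv_mul_cancel₀ hr, one_smul]
  calc Fintype.card n = (((r⁻¹ • U) * A) * V).rank := by rw [h1, Matrix.rank_one]
    _ ≤ ((r⁻¹ • U) * A).rank := Matrix.rank_mul_le_left _ _
    _ ≤ A.rank := Matrix.rank_mul_le_right _ _

lemma FiniteField.two_ne_zero_of_odd_card {F : Type*} [Field F] [Fintype F]
    (h : Odd (Fintype.card F)) : (2 : F) ≠ 0 := by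
  intro h2
  have hc : ringChar F = 2 :=
    CharP.ringChar_of_prime_eq_zero Nat.prime_two (by exact_mod_cast h2)
  have he := FiniteField.even_card_iff_char_two.mp hc
  rw [Nat.odd_iff] at h
  omega

/-- Pairing the vectors dual to the coordinates `X = x₀ + ε x₁`, `Y = y₀ + ε y₁` with those dual to
their conjugates turns `A∞` into a scalar matrix. -/
lemma Ainf_compression (q : ℕ) {F : Type} [Field F] (ε a b c : F) :
    !![ε, 1, 0, 0; 0, 0, ε, 1] * Ainf q ε a b c * !![ε, 0; -1, 0; 0, ε; 0, -1] =
      (-2 * ε ^ 2) • (1 : Matrix (Fin 2) (Fin 2) F) := by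
  ext i j
  fin_cases i <;> fin_cases j <;>
    simp [Ainf, Matrix.mul_apply, Fin.sum_univ_four] <;> ring

theorem two_le_rank_Ainf
    (q : ℕ) (hq : ∃ p n : ℕ, p.Prime ∧ Odd p ∧ 0 < n ∧ q = p ^ n)
    (F : Type) [Field F] [Fintype F] (hF : Fintype.card F = q ^ 2)
    (ε : F) (hε0 : ε ≠ 0) (hε : ε ^ q = -ε) (a b c : F) :
    2 ≤ (Ainf q ε a b c).rank := by
  obtain ⟨p, n, -, hp, -, rfl⟩ := hq
  have h2 : (2 : F) ≠ 0 :=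
    FiniteField.two_ne_zero_of_odd_card (by rw [hF]; exact hp.pow.pow)
  simpa using Matrix.le_rank_of_mul_mul_eq_smul_one _ _ _
    (mul_ne_zero (neg_ne_zero.mpr h2) (pow_ne_zero 2 hε0)) (Ainf_compression (p ^ n) ε a b c)
end

section
/- If the matrix A∞ has rank exactly 2, then 4ab − c² is a nonzero square in F (equivalently, the quadric z = ax²+by²+cxy+dx+ey+f is hyperbolic). -/
open Matrix in
/-- A `3 × 3` product factoring through a matrix of rank less than `3` is singular. -/
theorem det_mul_mul_eq_zero_of_rank_lt {F : Type} [Field F] {A : Matrix (Fin 4) (Fin 4) F}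
    (hA : A.rank < 3) (R : Matrix (Fin 3) (Fin 4) F) (C : Matrix (Fin 4) (Fin 3) F) :
    (R * A * C).det = 0 := by
  by_contra h
  have hunit : IsUnit (R * A * C) := (isUnit_iff_isUnit_det _).2 (isUnit_iff_ne_zero.2 h)
  have hfull := rank_of_isUnit _ hunit
  have hle := (rank_mul_le_left (R * A) C).trans (rank_mul_le_right R A)
  simp only [Fintype.card_fin] at hfull
  omega

/-- If `A∞` has rank less than `3`, the matrix `S` with rows `(2a, c)`, `(c, 2b)` is inverse to its
conjugate. -/
theorem hessian_mul_conj_of_rank_Ainf_lt {q : ℕ} {F : Type} [Field F] (h2 : (2 : F) ≠ 0)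
    {ε a b c : F} (hε0 : ε ≠ 0) (hA : (Ainf q ε a b c).rank < 3) :
    4 * a * a ^ q + c * c ^ q = 1 ∧ a * c ^ q + c * b ^ q = 0 ∧
      c * a ^ q + b * c ^ q = 0 ∧ c * c ^ q + 4 * b * b ^ q = 1 := by
  have key (s t u v : F) := det_mul_mul_eq_zero_of_rank_lt hA
    !![s * ε, s, t * ε, t; ε, -1, 0, 0; 0, 0, ε, -1]
    !![ε, 0, u * ε; 1, 0, -u; 0, ε, v * ε; 0, 1, -v]
  have h5 : (2 : F) ^ 5 * ε ^ 6 ≠ 0 := mul_ne_zero (pow_ne_zero _ h2) (pow_ne_zero _ hε0)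
  have h7 : (2 : F) ^ 7 * ε ^ 6 ≠ 0 := mul_ne_zero (pow_ne_zero _ h2) (pow_ne_zero _ hε0)
  have h11 := key 1 0 1 0
  have h12 := key 1 0 0 1
  have h21 := key 0 1 1 0
  have h22 := key 0 1 0 1
  simp [Ainf, Matrix.det_fin_three] at h11 h12 h21 h22
  field_simp at h11 h12 h21 h22
  ring_nf at h11 h12 h21 h22
  refine ⟨mul_left_cancel₀ h5 ?_, mul_left_cancel₀ h7 ?_, mul_left_cancel₀ h7 ?_,
    mul_left_cancel₀ h5 ?_⟩
  · linear_combination h11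
  · linear_combination h12
  · linear_combination h21
  · linear_combination h22

theorem rank_Ainf_eq_two_imp_hyperbolic
    (q : ℕ) (hq : ∃ p n : ℕ, p.Prime ∧ Odd p ∧ 0 < n ∧ q = p ^ n)
    (F : Type) [Field F] [Fintype F] (hF : Fintype.card F = q ^ 2)
    (ε : F) (hε0 : ε ≠ 0) (hε : ε ^ q = -ε) (a b c : F)
    (hrank : (Ainf q ε a b c).rank = 2) :
    IsSquare (4 * a * b - c ^ 2) ∧ 4 * a * b - c ^ 2 ≠ 0 := by
  obtain ⟨p, n, hp, hodd, hn, rfl⟩ := hq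
  have : Fact p.Prime := ⟨hp⟩
  have hchar : CharP F p := charP_of_card_eq_prime_pow (f := n * 2) (by
    rw [hF, pow_mul])
  have hp2 : p ≠ 2 := by rintro rfl; exact absurd hodd (by decide)
  have hF2 : ringChar F ≠ 2 := by rwa [ringChar.eq F p]
  obtain ⟨h11, h12, h21, h22⟩ := hessian_mul_conj_of_rank_Ainf_lt
    (Ring.two_ne_zero hF2) hε0 (by omega : (Ainf (p ^ n) ε a b c).rank < 3)
  have hconj : (4 * a * b - c ^ 2) ^ p ^ n =
      4 * a ^ p ^ n * b ^ p ^ n - (c ^ p ^ n) ^ 2 := by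
    simp only [← iterateFrobenius_def, map_sub, map_mul, map_pow, map_ofNat]
  have hnorm : (4 * a * b - c ^ 2) ^ (p ^ n + 1) = 1 := by
    rw [pow_succ, hconj]
    generalize a ^ p ^ n = a', b ^ p ^ n = b', c ^ p ^ n = c' at *
    linear_combination (4 * b * b' + c * c') * h11 + h22 -
      4 * (a * c' + c * b') * h21
  have hne : 4 * a * b - c ^ 2 ≠ 0 := by
    intro h
    rw [h, zero_pow (Nat.succ_ne_zero _)] at hnorm
    exact zero_ne_one hnorm
  refine ⟨(FiniteField.isSquare_iff hF2 hne).2 ?_, hne⟩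
  obtain ⟨k, hk⟩ := hodd.pow (n := n)
  have hexp : Fintype.card F / 2 = (p ^ n + 1) * k := by
    rw [hF, hk]
    have : (2 * k + 1) ^ 2 = 2 * ((2 * k + 1 + 1) * k) + 1 := by ring
    omega
  rw [hexp, pow_mul, hnorm, one_pow]
end

section
/- Let β be a generator of the multiplicative group of F, let a ∈ F with 4·a^(q+1) = 1, and set b = −β^(q−1)·a and c = 0. Then the number of pairs (x,y) ∈ F² with (x,y) ≠ (0,0) satisfying (a·x² + b·y²) + (a·x² + b·y²)^q = x^(q+1) + y^(q+1) equals 2q³ − q² − 1. (Equivalently, the associated quadric Ξ∞ of PG(3,q) is a pair of distinct planes, with 2q²+q+1 points.) -/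
section FrobeniusTwist

variable {F : Type*} [Field F] {p n : ℕ} [Fact p.Prime] [CharP F p]

/-- The additive map `x ↦ x ^ q - c * x` for `q = p ^ n` a power of the characteristic. -/
def frobeniusSubMul (p n : ℕ) [Fact p.Prime] [CharP F p] (c : F) : F →+ F :=
  (iterateFrobenius F p n).toAddMonoidHom - AddMonoidHom.mulLeft c

lemma frobeniusSubMul_apply (c x : F) :
    frobeniusSubMul p n c x = x ^ p ^ n - c * x := by
  simp [frobeniusSubMul, iterateFrobenius_def]

open Polynomial in
lemma ncard_pow_eq_mul_le {q : ℕ} (hq : 1 < q) (c : F) : {x : F | x ^ q = c * x}.ncard ≤ q := by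
  classical
  have hdeg : (X ^ q - C c * X : F[X]).natDegree = q := by
    rw [natDegree_sub_eq_left_of_natDegree_lt] <;> rw [natDegree_X_pow]
    exact (natDegree_C_mul_le c X).trans_lt (natDegree_X.trans_lt hq)
  have hne : (X ^ q - C c * X : F[X]) ≠ 0 := by
    intro h
    rw [h, natDegree_zero] at hdeg
    omega
  calc {x : F | x ^ q = c * x}.ncard
      ≤ ((X ^ q - C c * X : F[X]).roots.toFinset : Set F).ncard := by
        refine Set.ncard_le_ncard (fun x hx => ?_) (Finset.finite_toSet _)
        have hx' : x ^ q = c * x := hx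
        simp [mem_roots hne, hx']
    _ ≤ q := by
        rw [Set.ncard_coe_finset]
        exact (Multiset.toFinset_card_le _).trans ((card_roots' _).trans_eq hdeg)

lemma frobeniusSubMul_pow [Fintype F] (hF : Fintype.card F = (p ^ n) ^ 2) (c x : F)
    (hc : c ^ (p ^ n + 1) = 1) :
    frobeniusSubMul p n c x ^ p ^ n = -c ^ p ^ n * frobeniusSubMul p n c x := by
  have hx : (x ^ p ^ n) ^ p ^ n = x := by
    rw [← pow_mul, ← sq, ← hF, FiniteField.pow_card]
  rw [frobeniusSubMul_apply, sub_pow_char_pow, mul_pow, hx]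
  linear_combination -x * hc

lemma card_frobeniusSubMul [Fintype F] (hn : n ≠ 0) (hF : Fintype.card F = (p ^ n) ^ 2) {c : F}
    (hc : c ^ (p ^ n + 1) = 1) :
    Nat.card (frobeniusSubMul p n c).ker = p ^ n ∧
      Nat.card (frobeniusSubMul p n c).range = p ^ n := by
  have hq : 1 < p ^ n := Nat.one_lt_pow hn (Fact.out : p.Prime).one_lt
  have hker : Nat.card (frobeniusSubMul p n c).ker ≤ p ^ n := by
    refine le_trans (Set.ncard_le_ncard (fun x hx => ?_) (Set.toFinite _))
      (ncard_pow_eq_mul_le hq c)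
    have hx' : frobeniusSubMul p n c x = 0 := hx
    exact sub_eq_zero.1 ((frobeniusSubMul_apply c x).symm.trans hx')
  have hrange : Nat.card (frobeniusSubMul p n c).range ≤ p ^ n := by
    refine le_trans (Set.ncard_le_ncard ?_ (Set.toFinite _))
      (ncard_pow_eq_mul_le hq (-c ^ p ^ n))
    rintro _ ⟨x, rfl⟩
    exact frobeniusSubMul_pow hF c x hc
  have hmul := (frobeniusSubMul p n c).ker.card_mul_index
  rw [AddSubgroup.index_ker, Nat.card_eq_fintype_card (α := F), hF] at hmul
  constructor <;> nlinarith

/-- When multiplication by `g` carries the range of `x ↦ x ^ q - c * x` into that of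
`y ↦ y ^ q - d * y`, the relation `y ^ q - d * y = g * (x ^ q - c * x)` has `q ^ 3` solutions. -/
lemma ncard_frobeniusSubMul_eq_mul [Fintype F] (hn : n ≠ 0)
    (hF : Fintype.card F = (p ^ n) ^ 2) {c d g : F}
    (hc : c ^ (p ^ n + 1) = 1) (hd : d ^ (p ^ n + 1) = 1)
    (hg : g ^ p ^ n * c ^ p ^ n = d ^ p ^ n * g) :
    {z : F × F | frobeniusSubMul p n d z.2 = g * frobeniusSubMul p n c z.1}.ncard =
      (p ^ n) ^ 3 := by
  have hq : 1 < p ^ n := Nat.one_lt_pow hn (Fact.out : p.Prime).one_lt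
  let w : F × F →+ F := (frobeniusSubMul p n d).comp (AddMonoidHom.snd F F) -
    (AddMonoidHom.mulLeft g).comp ((frobeniusSubMul p n c).comp (AddMonoidHom.fst F F))
  have hw (z : F × F) : w z = frobeniusSubMul p n d z.2 - g * frobeniusSubMul p n c z.1 := rfl
  have hle : Nat.card w.range ≤ p ^ n := by
    refine le_trans (Set.ncard_le_ncard ?_ (Set.toFinite _))
      (ncard_pow_eq_mul_le hq (-d ^ p ^ n))
    rintro _ ⟨z, rfl⟩
    change w z ^ p ^ n = -d ^ p ^ n * w z
    rw [hw, sub_pow_char_pow, mul_pow, frobeniusSubMul_pow hF c _ hc,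
      frobeniusSubMul_pow hF d _ hd]
    linear_combination frobeniusSubMul p n c z.1 * hg
  have hge : p ^ n ≤ Nat.card w.range := by
    rw [← (card_frobeniusSubMul hn hF hd).2]
    refine Set.ncard_le_ncard ?_ (Set.toFinite _)
    rintro _ ⟨y, rfl⟩
    exact ⟨(0, y), by simp [hw]⟩
  have hmul := w.ker.card_mul_index
  rw [AddSubgroup.index_ker, Nat.card_eq_fintype_card (α := F × F), Fintype.card_prod, hF,
    le_antisymm hle hge] at hmul
  have hset : {z : F × F | frobeniusSubMul p n d z.2 = g * frobeniusSubMul p n c z.1} =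
      (w.ker : Set (F × F)) := by
    ext z
    simp [AddMonoidHom.mem_ker, hw, sub_eq_zero]
  rw [hset]
  change Nat.card w.ker = _
  apply Nat.eq_of_mul_eq_mul_right (by omega : 0 < p ^ n)
  rw [hmul]
  ring

end FrobeniusTwist

lemma pow_half_card_eq_neg_one_of_generator {F : Type*} [Field F] [Fintype F]
    (h2 : ringChar F ≠ 2) {β : F} (hβ0 : β ≠ 0) (hβ : ∀ x : F, x ≠ 0 → ∃ k : ℕ, x = β ^ k) :
    β ^ (Fintype.card F / 2) = -1 := by
  refine (FiniteField.pow_dichotomy h2 hβ0).resolve_left fun h => ?_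
  obtain ⟨x, hx⟩ := FiniteField.exists_nonsquare h2
  have hx0 : x ≠ 0 := by
    rintro rfl
    exact hx IsSquare.zero
  obtain ⟨k, rfl⟩ := hβ x hx0
  refine hx ((FiniteField.isSquare_iff h2 hx0).2 ?_)
  rw [← pow_mul, mul_comm, pow_mul, h, one_pow]

theorem two_lines_rank_two_count
    (q : ℕ) (hq : ∃ p n : ℕ, p.Prime ∧ Odd p ∧ 0 < n ∧ q = p ^ n)
    (F : Type) [Field F] [Fintype F] (hF : Fintype.card F = q ^ 2)
    (β : F) (hβ : ∀ x : F, x ≠ 0 → ∃ k : ℕ, x = β ^ k)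
    (a : F) (ha : 4 * a ^ (q + 1) = 1)
    (b : F) (hb : b = -β ^ (q - 1) * a) :
    Nat.card {p : F × F // p ≠ 0 ∧
        (a * p.1 ^ 2 + b * p.2 ^ 2) + (a * p.1 ^ 2 + b * p.2 ^ 2) ^ q =
          p.1 ^ (q + 1) + p.2 ^ (q + 1)} =
      2 * q ^ 3 - q ^ 2 - 1 := by
  obtain ⟨p, n, hp, hpodd, hn, rfl⟩ := hq
  have : Fact p.Prime := ⟨hp⟩
  have : CharP F p := charP_of_card_eq_prime_pow (f := n * 2) (by rw [hF, pow_mul])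
  have h2p : ringChar F ≠ 2 := by
    rw [ringChar.eq F p]
    rintro rfl
    exact absurd hpodd (by decide)
  have h2 : (2 : F) ≠ 0 := Ring.two_ne_zero h2p
  have hβ0 : β ≠ 0 := by
    rintro rfl
    obtain ⟨k, hk⟩ := hβ (-1) (by simp)
    rcases k with _ | k
    · exact Ring.neg_one_ne_one_of_char_ne_two h2p (by simpa using hk)
    · simp at hk
  obtain ⟨m, hm⟩ : Odd (p ^ n) := hpodd.pow
  have hqodd : Odd (p ^ n) := ⟨m, hm⟩
  obtain ⟨g, hgdef⟩ : ∃ g, g = β ^ m := ⟨_, rfl⟩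
  have hg0 : g ≠ 0 := hgdef ▸ pow_ne_zero _ hβ0
  have hgq : g ^ p ^ n * g = -1 := by
    rw [← pow_half_card_eq_neg_one_of_generator h2p hβ0 hβ, hF, hgdef, ← pow_succ, ← pow_mul, hm]
    congr 1
    have : (2 * m + 1) ^ 2 = 2 * (m * (2 * m + 1 + 1)) + 1 := by ring
    omega
  have hb' : b = -g ^ 2 * a := by
    rw [hb, hgdef, ← pow_mul, hm, Nat.add_sub_cancel, mul_comm m]
  have ha0 : a ≠ 0 := by
    rintro rfl
    simp at ha
  have h2q : (2 : F) ^ p ^ n = 2 := by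
    have := map_ofNat (iterateFrobenius F p n) 2
    rwa [iterateFrobenius_def] at this
  have haa : 4 * (a ^ p ^ n * a) = 1 := by rw [← pow_succ, ha]
  have hbq : b ^ p ^ n = -(g ^ p ^ n) ^ 2 * a ^ p ^ n := by
    rw [hb', mul_pow, hqodd.neg_pow, ← pow_mul, ← pow_mul, mul_comm 2]
  have hbb : 4 * (b ^ p ^ n * b) = 1 := by
    rw [hbq, hb']
    linear_combination (g ^ p ^ n * g) ^ 2 * haa + (g ^ p ^ n * g - 1) * hgq
  have hc : (2 * a) ^ (p ^ n + 1) = 1 := by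
    rw [pow_succ, mul_pow, h2q]
    linear_combination haa
  have hd : (2 * b) ^ (p ^ n + 1) = 1 := by
    rw [pow_succ, mul_pow, h2q]
    linear_combination hbb
  have hcomp : g ^ p ^ n * (2 * a) ^ p ^ n = (2 * b) ^ p ^ n * g := by
    rw [mul_pow, mul_pow, h2q, hbq]
    linear_combination 2 * g ^ p ^ n * a ^ p ^ n * hgq
  let u := frobeniusSubMul (F := F) p n (2 * a)
  let v := frobeniusSubMul (F := F) p n (2 * b)
  have h1 : {z : F × F | v z.2 = g * u z.1}.ncard = (p ^ n) ^ 3 :=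
    ncard_frobeniusSubMul_eq_mul hn.ne' hF hc hd hcomp
  have h1' : {z : F × F | v z.2 = -g * u z.1}.ncard = (p ^ n) ^ 3 :=
    ncard_frobeniusSubMul_eq_mul hn.ne' hF hc hd (by
      rw [hqodd.neg_pow]
      linear_combination -hcomp)
  have hinter : ({z : F × F | v z.2 = g * u z.1} ∩ {z | v z.2 = -g * u z.1}).ncard =
      (p ^ n) ^ 2 := by
    have : {z : F × F | v z.2 = g * u z.1} ∩ {z | v z.2 = -g * u z.1} =
        (u.ker : Set F) ×ˢ (v.ker : Set F) := by
      ext ⟨x, y⟩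
      simp only [Set.mem_inter_iff, Set.mem_ofPred_eq, Set.mem_prod, SetLike.mem_coe,
        AddMonoidHom.mem_ker]
      constructor
      · rintro ⟨h, h'⟩
        have hu : (2 * g) * u x = 0 := by linear_combination h' - h
        have hu' := (mul_eq_zero.1 hu).resolve_left (mul_ne_zero h2 hg0)
        exact ⟨hu', by rw [h, hu', mul_zero]⟩
      · rintro ⟨h, h'⟩
        simp [h, h']
    rw [this, Set.ncard_prod, sq]
    exact congr_arg₂ (· * ·) (card_frobeniusSubMul hn.ne' hF hc).1
      (card_frobeniusSubMul hn.ne' hF hd).1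
  have hset : {z : F × F | z ≠ 0 ∧ (a * z.1 ^ 2 + b * z.2 ^ 2) +
      (a * z.1 ^ 2 + b * z.2 ^ 2) ^ p ^ n = z.1 ^ (p ^ n + 1) + z.2 ^ (p ^ n + 1)} =
      ({z : F × F | v z.2 = g * u z.1} ∪ {z | v z.2 = -g * u z.1}) \ {0} := by
    ext ⟨x, y⟩
    simp only [Set.mem_sdiff, Set.mem_union, Set.mem_ofPred_eq, Set.mem_singleton_iff]
    rw [and_comm]
    refine and_congr_left fun _ => ?_
    have hu : u x = x ^ p ^ n - 2 * a * x := frobeniusSubMul_apply _ _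
    have hv : v y = y ^ p ^ n - 2 * b * y := frobeniusSubMul_apply _ _
    have key : 4 * a * g ^ 2 * ((a * x ^ 2 + b * y ^ 2) +
        (a * x ^ 2 + b * y ^ 2) ^ p ^ n - (x ^ (p ^ n + 1) + y ^ (p ^ n + 1))) =
        -((v y - g * u x) * (v y - -g * u x)) := by
      rw [hu, hv, add_pow_char_pow, mul_pow, mul_pow, ← pow_mul x, ← pow_mul y,
        mul_comm 2, pow_mul x, pow_mul y, pow_succ x (p ^ n),
        pow_succ y (p ^ n)]
      generalize x ^ p ^ n = X
      generalize y ^ p ^ n = Y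
      linear_combination g ^ 2 * X ^ 2 * haa - Y ^ 2 * hbb +
        (4 * b ^ p ^ n * Y ^ 2 + 4 * b * y ^ 2 - 4 * y * Y) * hb'
    have hne : 4 * a * g ^ 2 ≠ 0 := by
      have h4 : (4 : F) = 2 * 2 := by norm_num
      exact mul_ne_zero (mul_ne_zero (h4 ▸ mul_ne_zero h2 h2) ha0) (pow_ne_zero 2 hg0)
    rw [← sub_eq_zero, ← mul_eq_zero_iff_left hne, key, neg_eq_zero, mul_eq_zero,
      sub_eq_zero, sub_eq_zero]
  change Set.ncard {z : F × F | z ≠ 0 ∧ (a * z.1 ^ 2 + b * z.2 ^ 2) +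
      (a * z.1 ^ 2 + b * z.2 ^ 2) ^ p ^ n = z.1 ^ (p ^ n + 1) + z.2 ^ (p ^ n + 1)} = _
  rw [hset, Set.ncard_sdiff_singleton_of_mem (by simp)]
  have hadd := Set.ncard_union_add_ncard_inter {z : F × F | v z.2 = g * u z.1}
    {z | v z.2 = -g * u z.1}
  omega
end

section
/- Let β be a generator of the multiplicative group of F. Then the element u = 2 + β^(q−1) + β^(1−q) is a nonzero element of the subfield GF(q) of F which is a nonsquare in GF(q); equivalently, u^q = u, u ≠ 0 and u^((q−1)/2) = −1. (In the paper's notation, with b = β^(q−1)/2 this says 2(2b₀+1) is a nonsquare of GF(q), whence 2(2b₀+1)ε² is a square and the corresponding quadric splits into two planes.) -/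
/-- If every nonzero element of a finite field is a power of `β`, then `β ^ k = 1` with
`0 < k` forces `k` to be at least the number of nonzero elements. -/
theorem card_le_succ_of_pow_eq_one {F : Type*} [Field F] [Fintype F] {β : F}
    (hβ : ∀ x : F, x ≠ 0 → ∃ k : ℕ, x = β ^ k) {k : ℕ} (hk : 0 < k) (h : β ^ k = 1) :
    Fintype.card F ≤ k + 1 := by
  classical
  have hsub : (Finset.univ : Finset F) ⊆ insert 0 ((Finset.range k).image (β ^ ·)) := by
    intro x _
    rcases eq_or_ne x 0 with rfl | hx
    · simp
    · obtain ⟨j, rfl⟩ := hβ x hx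
      refine Finset.mem_insert_of_mem (Finset.mem_image.mpr
        ⟨j % k, Finset.mem_range.mpr (Nat.mod_lt _ hk), ?_⟩)
      exact (pow_eq_pow_mod j h).symm
  calc Fintype.card F = (Finset.univ : Finset F).card := Finset.card_univ.symm
    _ ≤ _ := Finset.card_le_card hsub
    _ ≤ _ := Finset.card_insert_le _ _
    _ ≤ k + 1 := by
      simpa using Finset.card_image_le (s := Finset.range k) (f := (β ^ ·))

/-- In a field of cardinality `q ^ 2`, where `q` is a prime power, raising to the power `q` is
additive. -/
theorem add_pow_of_card_eq_sq {F : Type*} [Field F] [Fintype F] {q p n : ℕ} (hp : p.Prime)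
    (hq : q = p ^ n) (hF : Fintype.card F = q ^ 2) (x y : F) :
    (x + y) ^ q = x ^ q + y ^ q := by
  have : Fact p.Prime := ⟨hp⟩
  have hz : (p : F) = 0 := by
    have h := Nat.cast_card_eq_zero F
    rw [hF, hq] at h
    push_cast at h
    exact eq_zero_of_pow_eq_zero (eq_zero_of_pow_eq_zero h)
  have : CharP F p := (CharP.charP_iff_prime_eq_zero hp).mpr hz
  rw [hq, add_pow_char_pow]

theorem nonsquare_element
    (q : ℕ) (hq : ∃ p n : ℕ, p.Prime ∧ Odd p ∧ 0 < n ∧ q = p ^ n)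
    (F : Type) [Field F] [Fintype F] (hF : Fintype.card F = q ^ 2)
    (β : F) (hβ : ∀ x : F, x ≠ 0 → ∃ k : ℕ, x = β ^ k) :
    (2 + β ^ (q - 1) + (β ^ (q - 1))⁻¹) ^ q = 2 + β ^ (q - 1) + (β ^ (q - 1))⁻¹ ∧
    2 + β ^ (q - 1) + (β ^ (q - 1))⁻¹ ≠ 0 ∧
    (2 + β ^ (q - 1) + (β ^ (q - 1))⁻¹) ^ ((q - 1) / 2) = -1 := by
  obtain ⟨p, n, hp, hodd, hn, hqp⟩ := hq
  have hadd := fun x y : F => add_pow_of_card_eq_sq hp hqp hF x y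
  have hq1 : 1 < q := hqp ▸ Nat.one_lt_pow hn.ne' hp.one_lt
  obtain ⟨m, hm⟩ : Odd q := hqp ▸ hodd.pow
  have hm0 : 0 < m := by omega
  have hβ0 : β ≠ 0 := by
    rintro rfl
    have := card_le_succ_of_pow_eq_one (β := (1 : F)) (k := 1) (fun x hx => by
      obtain ⟨k, rfl⟩ := hβ x hx
      rcases Nat.eq_zero_or_pos k with rfl | hk
      · exact ⟨0, by simp⟩
      · exact absurd (zero_pow hk.ne') hx) one_pos (one_pow 1)
    rw [hF] at this
    nlinarith
  have hlarge : ∀ k : ℕ, 0 < k → k + 1 < q ^ 2 → β ^ k ≠ 1 := fun k hk hkq h =>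
    absurd (card_le_succ_of_pow_eq_one hβ hk h) (by omega)
  set g := β ^ m with hg
  have hg0 : g ≠ 0 := pow_ne_zero _ hβ0
  have hgq : g ^ (q + 1) = -1 := by
    have hsq : g ^ (q + 1) * g ^ (q + 1) = 1 := by
      rw [← FiniteField.pow_card_sub_one_eq_one β hβ0, hF, hg, ← pow_mul, ← pow_add]
      congr 1
      apply Nat.eq_sub_of_add_eq
      rw [hm]
      ring
    refine (mul_self_eq_one_iff.mp hsq).resolve_left ?_
    rw [hg, ← pow_mul]
    exact hlarge _ (by positivity) (by rw [hm]; nlinarith)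
  have hgq' : g ^ q = -g⁻¹ := by
    rw [pow_succ] at hgq
    field_simp
    exact hgq
  have hβg : β ^ (q - 1) = g ^ 2 := by
    rw [hg, ← pow_mul]
    congr 1
    omega
  have hu : 2 + β ^ (q - 1) + (β ^ (q - 1))⁻¹ = (g + g⁻¹) ^ 2 := by
    rw [hβg]
    field_simp
    ring
  have hwq : (g + g⁻¹) ^ q = -(g + g⁻¹) := by
    rw [hadd, inv_pow, hgq', inv_neg, inv_inv]
    ring
  have hw0 : g + g⁻¹ ≠ 0 := by
    intro h
    have h2 : g ^ 2 = -1 := by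
      field_simp at h
      linear_combination h
    refine hlarge (m * 4) (by positivity) (by rw [hm]; nlinarith) ?_
    rw [pow_mul, ← hg]
    linear_combination (g ^ 2 - 1) * h2
  rw [hu]
  refine ⟨?_, pow_ne_zero _ hw0, ?_⟩
  · rw [← pow_mul, mul_comm, pow_mul, hwq, neg_sq]
  · rw [← pow_mul, show 2 * ((q - 1) / 2) = q - 1 by omega]
    apply mul_right_cancel₀ hw0
    rw [← pow_succ, Nat.sub_add_cancel hq1.le, hwq, neg_one_mul]
end

section
/- Let β be a generator of the multiplicative group of F and let s be a nonnegative integer. Set a = β^(s(q−1))/2 and b = −β^((s+1)(q−1))/2. Then the element v = −(a^q + a + 1)·(b^q + b + 1) lies in the subfield GF(q) of F and is a square in GF(q) (i.e. v = t² for some t ∈ GF(q)). (In the paper's notation this says −(2a₀+1)(2b₀+1) is a square of GF(q), so the quadric (2a₀+1)u² + (2b₀+1)w² = 0 splits into two planes over GF(q).) -/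
/-- In a finite field with `q ^ 2` elements, `q` odd, the power `β ^ ((q - 1) / 2)` of a generator
has norm `-1` over the subfield with `q` elements. -/
theorem generator_half_pow_norm {F : Type*} [Field F] [Fintype F] {m : ℕ}
    (hF : Fintype.card F = (2 * m + 1) ^ 2) (h2 : (2 : F) ≠ 0)
    {β : F} (hβ : ∀ x : F, x ≠ 0 → ∃ k : ℕ, x = β ^ k) :
    β ^ m ≠ 0 ∧ (β ^ m) ^ (2 * m + 1) * β ^ m = -1 := by
  have hchar : ringChar F ≠ 2 := fun h => h2 <| by
    have := ringChar.Nat.cast_ringChar (R := F)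
    rw [h] at this
    exact_mod_cast this
  have hβ0 : β ≠ 0 := by
    rintro rfl
    obtain ⟨k, hk⟩ := hβ (-1) (by simp)
    rcases Nat.eq_zero_or_pos k with rfl | hk0
    · exact Ring.neg_one_ne_one_of_char_ne_two hchar (by simpa using hk)
    · simp [zero_pow hk0.ne'] at hk
  have hhalf : Fintype.card F / 2 = m * (2 * m + 1) + m := by
    rw [hF]
    have : (2 * m + 1) ^ 2 = 2 * (m * (2 * m + 1) + m) + 1 := by ring
    omega
  refine ⟨pow_ne_zero _ hβ0, ?_⟩
  rw [← pow_mul, ← pow_add, ← hhalf]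
  refine (FiniteField.pow_dichotomy hchar hβ0).resolve_left fun h => ?_
  obtain ⟨x, hx⟩ := FiniteField.exists_nonsquare hchar
  have hx0 : x ≠ 0 := by
    rintro rfl
    exact hx (IsSquare.zero)
  obtain ⟨k, rfl⟩ := hβ x hx0
  exact hx (((FiniteField.isSquare_iff hchar hβ0).2 h).pow k)

theorem minus_prod_is_square
    (q : ℕ) (hq : ∃ p n : ℕ, p.Prime ∧ Odd p ∧ 0 < n ∧ q = p ^ n)
    (F : Type) [Field F] [Fintype F] (hF : Fintype.card F = q ^ 2)
    (β : F) (hβ : ∀ x : F, x ≠ 0 → ∃ k : ℕ, x = β ^ k)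
    (s : ℕ) (a b : F)
    (ha : a = β ^ (s * (q - 1)) / 2)
    (hb : b = -(β ^ ((s + 1) * (q - 1)) / 2)) :
    (-((a ^ q + a + 1) * (b ^ q + b + 1))) ^ q =
      -((a ^ q + a + 1) * (b ^ q + b + 1)) ∧
    ∃ t : F, t ^ q = t ∧ -((a ^ q + a + 1) * (b ^ q + b + 1)) = t ^ 2 := by
  obtain ⟨p, n, hp, hpo, -, hqp⟩ := hq
  have : Fact p.Prime := ⟨hp⟩
  have : CharP F p := charP_of_card_eq_prime_pow (f := n * 2) (by
    rw [hF, hqp, pow_mul])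
  have hqo : Odd q := hqp ▸ hpo.pow
  have hadd (x y : F) : (x + y) ^ q = x ^ q + y ^ q := by
    rw [hqp, add_pow_char_pow]
  have h2 : (2 : F) ≠ 0 := fun h => by
    have h' : ((2 : ℕ) : F) = 0 := by exact_mod_cast h
    rw [CharP.cast_eq_zero_iff F p, Nat.prime_dvd_prime_iff_eq hp Nat.prime_two] at h'
    exact absurd (h' ▸ hpo) (by decide)
  have h2q : (2 : F) ^ q = 2 := by
    rw [← one_add_one_eq_two, hadd, one_pow]
  obtain ⟨m, hm⟩ := hqo
  obtain ⟨hw, hnorm⟩ := generator_half_pow_norm (hm ▸ hF) h2 hβ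
  rw [← hm] at hnorm
  have hpow (j : ℕ) : β ^ (j * (q - 1)) = ((β ^ m) ^ j) ^ 2 := by
    rw [← pow_mul, ← pow_mul, hm]
    congr 1
    rw [Nat.add_sub_cancel]
    ring
  rw [hpow] at ha hb
  rw [pow_succ (β ^ m) s] at hb
  generalize β ^ m = w at hw hnorm ha hb
  have hwq : w ^ q = -w⁻¹ := by
    field_simp
    exact hnorm
  set y := w ^ s with hy
  have hy0 : y ≠ 0 := pow_ne_zero _ hw
  have hyq : y ^ q = (-1) ^ s * y⁻¹ := by
    rw [hy, pow_right_comm, hwq, neg_pow, inv_pow]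
  have hsign : ((-1 : F) ^ s) ^ 2 = 1 := by rw [pow_right_comm]; simp
  have hinv (x : F) : x⁻¹ ^ q = (x ^ q)⁻¹ := inv_pow x q
  have hneg (x : F) : (-x) ^ q = -x ^ q := Odd.neg_pow ⟨m, hm⟩ x
  have haq : a ^ q = (y⁻¹) ^ 2 / 2 := by
    rw [ha, div_pow, h2q, pow_right_comm, hyq, mul_pow, hsign, one_mul]
  have hbq : b ^ q = -((y * w)⁻¹ ^ 2 / 2) := by
    rw [hb, hneg, div_pow, h2q, pow_right_comm, mul_pow y, hyq, hwq, mul_pow,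
      mul_pow, hsign, neg_sq, mul_inv, mul_pow, one_mul]
  obtain ⟨t, htq, ht⟩ : ∃ t : F, t ^ q = t ∧
      -((a ^ q + a + 1) * (b ^ q + b + 1)) = t ^ 2 := by
    refine ⟨(y + y⁻¹) * (y * w - (y * w)⁻¹) / 2, ?_, ?_⟩
    · rw [div_pow, h2q, mul_pow, sub_eq_add_neg, hadd, hadd, hneg, hinv, hinv, mul_pow, hyq, hwq]
      rcases neg_one_pow_eq_or F s with h | h <;> rw [h] <;> field_simp <;> ring
    · rw [haq, hbq, ha, hb]
      field_simp
      ring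
  exact ⟨by rw [ht, pow_right_comm, htq], t, htq, ht⟩
end

section
/- Let c ∈ F with c^(q+1) = 1. Then the number of pairs (x,y) ∈ F² with (x,y) ≠ (0,0) satisfying c·x·y + (c·x·y)^q = x^(q+1) + y^(q+1) equals q² − 1. (Equivalently, the associated quadric Ξ∞ of PG(3,q) is a line, with exactly q+1 points.) -/
/-- Over a field with `q²` elements, if `c` has norm `1` then the quadratic form
`N(x) + N(y) - Tr(cxy)` equals `N(cx - y^q)`, hence vanishes only where `cx = y^q`. -/
theorem trace_mul_eq_norm_add_norm_iff {F : Type*} [Field F] {p n : ℕ} [Fact p.Prime] [CharP F p]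
    (hF : ∀ z : F, z ^ (p ^ n * p ^ n) = z) {c : F} (hc : c ^ (p ^ n + 1) = 1) (x y : F) :
    c * x * y + (c * x * y) ^ p ^ n = x ^ (p ^ n + 1) + y ^ (p ^ n + 1) ↔ c * x = y ^ p ^ n := by
  have key : (c * x - y ^ p ^ n) ^ (p ^ n + 1) =
      x ^ (p ^ n + 1) + y ^ (p ^ n + 1) - (c * x * y + (c * x * y) ^ p ^ n) := by
    rw [pow_succ (c * x - y ^ p ^ n), sub_pow_char_pow, ← pow_mul, hF]
    simp only [mul_pow, pow_succ] at hc ⊢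
    linear_combination (x ^ p ^ n * x) * hc
  rw [eq_comm, ← sub_eq_zero, ← key, pow_eq_zero_iff (Nat.succ_ne_zero _), sub_eq_zero]

theorem single_point_rank_two_count
    (q : ℕ) (hq : ∃ p n : ℕ, p.Prime ∧ Odd p ∧ 0 < n ∧ q = p ^ n)
    (F : Type) [Field F] [Fintype F] (hF : Fintype.card F = q ^ 2)
    (c : F) (hc : c ^ (q + 1) = 1) :
    Nat.card {p : F × F // p ≠ 0 ∧
        c * p.1 * p.2 + (c * p.1 * p.2) ^ q = p.1 ^ (q + 1) + p.2 ^ (q + 1)} =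
      q ^ 2 - 1 := by
  obtain ⟨p, n, hp, -, -, rfl⟩ := hq
  have : Fact p.Prime := ⟨hp⟩
  have : CharP F p := charP_of_card_eq_prime_pow (f := n * 2) (by rw [hF, pow_mul])
  have hpow : ∀ z : F, z ^ (p ^ n * p ^ n) = z := fun z => by
    rw [← sq, ← hF, FiniteField.pow_card]
  have hc0 : c ≠ 0 := by
    rintro rfl
    simp at hc
  have hq0 : p ^ n ≠ 0 := pow_ne_zero _ hp.ne_zero
  simp only [trace_mul_eq_norm_add_norm_iff hpow hc]
  let e : {v : F × F // v ≠ 0 ∧ c * v.1 = v.2 ^ p ^ n} ≃ {y : F // y ≠ 0} :=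
    { toFun := fun v => ⟨v.1.2, fun h => v.2.1 <| Prod.ext
        (by simpa [h, zero_pow hq0, hc0] using v.2.2) h⟩
      invFun := fun y => ⟨(c⁻¹ * y.1 ^ p ^ n, y.1), fun h => y.2 (congrArg Prod.snd h),
        mul_inv_cancel_left₀ hc0 _⟩
      left_inv := fun v => Subtype.ext <| Prod.ext
        (by simp only [← v.2.2, inv_mul_cancel_left₀ hc0]) rfl
      right_inv := fun _ => rfl }
  classical
  rw [Nat.card_congr e, Nat.card_eq_fintype_card, Fintype.card_subtype_compl,
    Fintype.card_subtype_eq, hF]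
end

section
/- Suppose (a,b,c) ≠ (0,0,0) (so Q is irreducible) and the number of points of PG(3,q²) lying on both H and Q is exactly q² + 1. Then Δ = 4ab − c² is a nonzero square in F (Q is hyperbolic), and H ∩ Q is an ovoid of Q: every 2-dimensional F-subspace W of F⁴ on which the quadratic form j·z − a·x² − b·y² − c·x·y − d·x·j − e·y·j − f·j² vanishes identically (i.e. every line contained in Q) contains exactly one projective point of H ∩ Q. -/
/-- The Hermitian surface `H` of `PG(3,q²)`. -/
def hermPt (q : ℕ) {F : Type} [Field F] (v : Fin 4 → F) : Prop :=
  (v 0) ^ q * v 3 + v 0 * (v 3) ^ q = (v 1) ^ (q + 1) + (v 2) ^ (q + 1)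

/-- The quadratic form defining the quadric `Q`. -/
def quadForm {F : Type} [Field F] (a b c d e f : F) (v : Fin 4 → F) : F :=
  v 0 * v 3 - a * (v 1) ^ 2 - b * (v 2) ^ 2 - c * (v 1) * (v 2) -
    d * (v 1) * (v 0) - e * (v 2) * (v 0) - f * (v 0) ^ 2

section Counting

variable {F : Type} [Field F] [Fintype F] [DecidableEq F] {q : ℕ}

open Finset

theorem card_pow_eq_linear_le (hq : 1 < q) (α k : F) :
    #{x : F | x ^ q = α * x + k} ≤ q := by
  classical
  set P : Polynomial F := Polynomial.X ^ q - (Polynomial.C α * Polynomial.X + Polynomial.C k)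
  have hdeg : P.degree = q := by
    rw [← Polynomial.degree_X_pow (R := F) q]
    apply Polynomial.degree_sub_eq_left_of_degree_lt
    rw [Polynomial.degree_X_pow]
    exact lt_of_le_of_lt Polynomial.degree_linear_le (by exact_mod_cast hq)
  have hP : P ≠ 0 := by
    intro h
    rw [h, Polynomial.degree_zero] at hdeg
    exact absurd hdeg (by simp)
  have hsub : ({x : F | x ^ q = α * x + k} : Finset F) ⊆ P.roots.toFinset := by
    intro x hx
    rw [mem_filter] at hx
    simp [P, hP, hx.2]
  calc _ ≤ #P.roots.toFinset := card_le_card hsub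
    _ ≤ P.roots.card := Multiset.toFinset_card_le _
    _ ≤ P.natDegree := P.card_roots'
    _ = q := Polynomial.natDegree_eq_of_degree_eq_some hdeg

theorem card_fixed_and_trace_fibre (hq : 1 < q) (hF : Fintype.card F = q ^ 2)
    (hadd : ∀ x y : F, (x + y) ^ q = x ^ q + y ^ q) (hinv : ∀ x : F, (x ^ q) ^ q = x) :
    #{x : F | x ^ q = x} = q ∧ ∀ k : F, k ^ q = k → #{x : F | x ^ q + x = k} = q := by
  have hfib : ∀ k : F, #{x : F | x ^ q + x = k} ≤ q := by
    intro k
    refine le_trans (card_le_card ?_) (card_pow_eq_linear_le hq (-1) k)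
    intro x
    simp only [mem_filter, mem_univ, true_and]
    intro h
    linear_combination h
  have hK : #{x : F | x ^ q = x} ≤ q := by
    simpa using card_pow_eq_linear_le hq (1 : F) 0
  have hsum : q ^ 2 = ∑ k ∈ ({x : F | x ^ q = x} : Finset F), #{x : F | x ^ q + x = k} := by
    rw [← hF, ← card_univ]
    refine card_eq_sum_card_fiberwise (f := fun x : F => x ^ q + x) ?_
    intro x _
    simp [hadd, hinv, add_comm]
  have hle : ∑ k ∈ ({x : F | x ^ q = x} : Finset F), #{x : F | x ^ q + x = k}
      ≤ #{x : F | x ^ q = x} * q := by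
    simpa using sum_le_card_nsmul ({x : F | x ^ q = x} : Finset F) _ q (fun k _ => hfib k)
  have hKq : #{x : F | x ^ q = x} = q := by
    nlinarith
  refine ⟨hKq, fun k hk => ?_⟩
  have heq : ∑ k ∈ ({x : F | x ^ q = x} : Finset F), #{x : F | x ^ q + x = k}
      = ∑ k ∈ ({x : F | x ^ q = x} : Finset F), q := by
    rw [← hsum, sum_const, hKq, smul_eq_mul, sq]
  exact (sum_eq_sum_iff_of_le (fun i _ => hfib i)).1 heq k (by simpa using hk)

theorem card_trace_linear_fibre (hq : 1 < q) (hF : Fintype.card F = q ^ 2)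
    (hadd : ∀ x y : F, (x + y) ^ q = x ^ q + y ^ q) (hinv : ∀ x : F, (x ^ q) ^ q = x)
    {α β : F} (hαβ : ¬ (α = 0 ∧ β = 0)) {k : F} (hk : k ^ q = k) :
    #{v : F × F | (α * v.1 + β * v.2) ^ q + (α * v.1 + β * v.2) = k} = q ^ 3 := by
  have htr := (card_fixed_and_trace_fibre hq hF hadd hinv).2 k hk
  have hprod : #(({x : F | x ^ q + x = k} : Finset F) ×ˢ (univ : Finset F)) = q ^ 3 := by
    rw [card_product, htr, card_univ, hF]; ring
  rw [← hprod]
  by_cases hα : α = 0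
  · have hβ : β ≠ 0 := fun h => hαβ ⟨hα, h⟩
    refine card_bij' (fun v _ => (α * v.1 + β * v.2, v.1)) (fun v _ => (v.2, v.1 / β)) ?_ ?_ ?_ ?_
    · simp
    · rintro ⟨x, y⟩ h
      simp only [hα, mem_product, mem_filter, mem_univ, true_and, and_true] at h ⊢
      rwa [zero_mul, zero_add, mul_div_cancel₀ _ hβ]
    · rintro ⟨x, y⟩ _
      simp [hα, hβ]
    · rintro ⟨x, y⟩ _
      simp [hα, mul_div_cancel₀ _ hβ]
  · refine card_bij' (fun v _ => (α * v.1 + β * v.2, v.2))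
      (fun v _ => ((v.1 - β * v.2) / α, v.2)) ?_ ?_ ?_ ?_
    · simp
    · rintro ⟨x, y⟩ h
      simp only [mem_product, mem_filter, mem_univ, true_and, and_true] at h ⊢
      rwa [mul_div_cancel₀ _ hα, sub_add_cancel]
    · rintro ⟨x, y⟩ _
      simp [hα]
    · rintro ⟨x, y⟩ _
      simp [mul_div_cancel₀ _ hα]

/-- The quadratic polynomial whose graph is the affine part of `Q`. -/
def quadPoly (a b c d e f : F) (v : F × F) : F :=
  a * v.1 ^ 2 + b * v.2 ^ 2 + c * v.1 * v.2 + d * v.1 + e * v.2 + f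

/-- The equation of the affine part of `H ∩ Q` in terms of the coordinates `x`, `y`. -/
def affineEq (q : ℕ) (a b c d e f : F) (v : F × F) : F :=
  quadPoly a b c d e f v ^ q + quadPoly a b c d e f v - (v.1 ^ (q + 1) + v.2 ^ (q + 1))

/-- The radical of the quadratic part of `affineEq` over the subfield of order `q`. -/
def radical (q : ℕ) (a b c : F) : Finset (F × F) :=
  {u : F × F | u.1 ^ q = 2 * a * u.1 + c * u.2 ∧ u.2 ^ q = c * u.1 + 2 * b * u.2}

omit [Fintype F] [DecidableEq F] in
theorem affineEq_fixed (hadd : ∀ x y : F, (x + y) ^ q = x ^ q + y ^ q)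
    (hinv : ∀ x : F, (x ^ q) ^ q = x) (a b c d e f : F) (v : F × F) :
    affineEq q a b c d e f v ^ q = affineEq q a b c d e f v := by
  have hsub : ∀ x y : F, (x - y) ^ q = x ^ q - y ^ q := fun x y => by
    have := hadd (x - y) y
    rw [sub_add_cancel] at this
    linear_combination -this
  unfold affineEq
  simp only [hsub, hadd, pow_succ, mul_pow, hinv]
  ring

omit [Fintype F] [DecidableEq F] in
theorem affineEq_add (hadd : ∀ x y : F, (x + y) ^ q = x ^ q + y ^ q)
    (hinv : ∀ x : F, (x ^ q) ^ q = x) (a b c d e f : F) (v u : F × F) :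
    affineEq q a b c d e f (v + u) = affineEq q a b c d e f v +
      ((((2 * a * u.1 + c * u.2 - u.1 ^ q) * v.1 + (c * u.1 + 2 * b * u.2 - u.2 ^ q) * v.2) ^ q
        + ((2 * a * u.1 + c * u.2 - u.1 ^ q) * v.1 + (c * u.1 + 2 * b * u.2 - u.2 ^ q) * v.2))
      + (affineEq q a b c d e f u - (f ^ q + f))) := by
  have hsub : ∀ x y : F, (x - y) ^ q = x ^ q - y ^ q := fun x y => by
    have := hadd (x - y) y
    rw [sub_add_cancel] at this
    linear_combination -this
  simp only [affineEq, quadPoly, Prod.fst_add, Prod.snd_add, hsub, hadd, mul_pow,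
    hinv, two_mul, sq, pow_succ _ q]
  ring

omit [Fintype F] [DecidableEq F] in
/-- On the radical, the quadratic part of `affineEq` vanishes. -/
theorem trace_form_eq_of_mem_radical (h2 : (2 : F) ≠ 0)
    (hadd : ∀ x y : F, (x + y) ^ q = x ^ q + y ^ q) (hinv : ∀ x : F, (x ^ q) ^ q = x)
    {a b c x y : F} (hx : x ^ q = 2 * a * x + c * y) (hy : y ^ q = c * x + 2 * b * y) :
    (a * x ^ 2 + b * y ^ 2 + c * x * y) ^ q + (a * x ^ 2 + b * y ^ 2 + c * x * y)
      = x ^ (q + 1) + y ^ (q + 1) := by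
  set s := a * x ^ 2 + b * y ^ 2 + c * x * y with hs
  have h2s : s + s = x ^ q * x + y ^ q * y := by rw [hx, hy, hs]; ring
  have h3 : (s + s) ^ q = s + s := by
    rw [h2s, hadd, mul_pow, mul_pow, hinv, hinv]; ring
  rw [hadd] at h3
  have h4 : s ^ q = s := mul_left_cancel₀ h2 (by linear_combination h3)
  rw [h4, h2s, pow_succ, pow_succ]

theorem card_radical_le (hq : 1 < q) (hF : Fintype.card F = q ^ 2) (a b c : F) :
    #(radical q a b c) ≤ q ^ 2 := by
  by_cases hc : c = 0
  · calc #(radical q a b c)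
        ≤ #(({x : F | x ^ q = 2 * a * x + 0} : Finset F) ×ˢ
            ({x : F | x ^ q = 2 * b * x + 0} : Finset F)) := by
          apply card_le_card
          intro u
          simp [radical, hc]
      _ ≤ q * q := by
          rw [card_product]
          exact Nat.mul_le_mul (card_pow_eq_linear_le hq _ _) (card_pow_eq_linear_le hq _ _)
      _ = q ^ 2 := (sq q).symm
  · rw [← hF, ← card_univ]
    refine card_le_card_of_injOn Prod.fst (by simp) ?_
    rintro ⟨x, y⟩ h ⟨x', y'⟩ h' hxx
    simp only [radical, coe_filter, mem_univ, true_and, Set.mem_ofPred_eq] at h h' hxx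
    subst hxx
    have := h.1.symm.trans h'.1
    have : y = y' := mul_left_cancel₀ hc (by linear_combination this)
    rw [this]

theorem sum_card_translate_eq (hq : 1 < q) (hF : Fintype.card F = q ^ 2) (h2 : (2 : F) ≠ 0)
    (hadd : ∀ x y : F, (x + y) ^ q = x ^ q + y ^ q) (hinv : ∀ x : F, (x ^ q) ^ q = x)
    (a b c d e f : F) :
    ∑ u : F × F, #{v | affineEq q a b c d e f (v + u) = affineEq q a b c d e f v}
      + q ^ 3 * #(radical q a b c) = q ^ 7 + q ^ 4 *
        #{u ∈ radical q a b c | (d * u.1 + e * u.2) ^ q + (d * u.1 + e * u.2) = 0} := by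
  set R := radical q a b c
  have hcard : Fintype.card (F × F) = q ^ 4 := by rw [Fintype.card_prod, hF]; ring
  have hterm : ∀ u : F × F,
      #{v | affineEq q a b c d e f (v + u) = affineEq q a b c d e f v}
        + (if u ∈ R then q ^ 3 else 0) = q ^ 3 +
      (if u ∈ R ∧ (d * u.1 + e * u.2) ^ q + (d * u.1 + e * u.2) = 0 then q ^ 4 else 0) := by
    intro u
    by_cases hu : u ∈ R
    · have hu' := (mem_filter.1 hu).2
      have hg : affineEq q a b c d e f u - (f ^ q + f)
          = (d * u.1 + e * u.2) ^ q + (d * u.1 + e * u.2) := by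
        have := trace_form_eq_of_mem_radical h2 hadd hinv hu'.1 hu'.2
        simp only [hadd] at this
        simp only [affineEq, quadPoly, hadd]
        linear_combination this
      have hg' : ∀ v, affineEq q a b c d e f (v + u) = affineEq q a b c d e f v ↔
          (d * u.1 + e * u.2) ^ q + (d * u.1 + e * u.2) = 0 := by
        intro v
        rw [affineEq_add hadd hinv, hg, ← hu'.1, ← hu'.2]
        simp [show q ≠ 0 by omega]
      by_cases h : (d * u.1 + e * u.2) ^ q + (d * u.1 + e * u.2) = 0
      · simp [hg', hu, h, hF]; ring
      · simp [hg', hu, h]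
    · have hne : ¬ (2 * a * u.1 + c * u.2 - u.1 ^ q = 0 ∧ c * u.1 + 2 * b * u.2 - u.2 ^ q = 0) := by
        intro h
        apply hu
        simp only [R, radical, mem_filter, mem_univ, true_and]
        exact ⟨(sub_eq_zero.1 h.1).symm, (sub_eq_zero.1 h.2).symm⟩
      have hk : (f ^ q + f - affineEq q a b c d e f u) ^ q
          = f ^ q + f - affineEq q a b c d e f u := by
        have := hadd (f ^ q + f - affineEq q a b c d e f u) (affineEq q a b c d e f u)
        rw [sub_add_cancel, affineEq_fixed hadd hinv, hadd, hinv] at this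
        linear_combination -this
      have := card_trace_linear_fibre hq hF hadd hinv hne hk
      simp only [hu, if_false, false_and, add_zero]
      rw [← this]
      congr 1
      ext v
      simp only [mem_filter, mem_univ, true_and]
      rw [affineEq_add hadd hinv]
      constructor <;> intro h <;> linear_combination h
  have hsum := Finset.sum_congr (rfl : (univ : Finset (F × F)) = univ) (fun u _ => hterm u)
  rw [sum_add_distrib, sum_add_distrib, ← sum_filter, ← sum_filter, sum_const, sum_const,
    sum_const, card_univ, hcard] at hsum
  simp only [smul_eq_mul] at hsum
  have hR : ({u | u ∈ R} : Finset (F × F)) = R := by ext; simp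
  have hR0 : ({u | u ∈ R ∧ (d * u.1 + e * u.2) ^ q + (d * u.1 + e * u.2) = 0} : Finset (F × F))
      = {u ∈ R | (d * u.1 + e * u.2) ^ q + (d * u.1 + e * u.2) = 0} := by ext; simp
  rw [hR, hR0] at hsum
  linear_combination hsum

theorem sum_sq_card_fibre (hadd : ∀ x y : F, (x + y) ^ q = x ^ q + y ^ q)
    (hinv : ∀ x : F, (x ^ q) ^ q = x) (a b c d e f : F) :
    ∑ u : F × F, #{v | affineEq q a b c d e f (v + u) = affineEq q a b c d e f v}
      = ∑ k ∈ ({x : F | x ^ q = x} : Finset F), #{v | affineEq q a b c d e f v = k} ^ 2 := by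
  set g := affineEq q a b c d e f with hg
  calc ∑ u : F × F, #{v | g (v + u) = g v}
      = ∑ v : F × F, #{u | g (v + u) = g v} := by
        simp only [card_filter]
        exact sum_comm
    _ = ∑ v : F × F, #{w | g w = g v} := by
        refine sum_congr rfl fun v _ => ?_
        exact card_equiv (Equiv.addLeft v) (by simp)
    _ = ∑ k ∈ ({x : F | x ^ q = x} : Finset F), ∑ v : F × F with g v = k, #{w | g w = g v} := by
        symm
        apply sum_fiberwise_of_maps_to
        intro v _
        simpa using affineEq_fixed hadd hinv a b c d e f v
    _ = _ := by
        refine sum_congr rfl fun k _ => ?_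
        rw [sq, ← smul_eq_mul, ← sum_const]
        refine sum_congr rfl fun v hv => ?_
        rw [(mem_filter.1 hv).2]

theorem variance_bound {q n r r₀ E : ℤ} (hq : 2 < q) (hn₀ : 0 ≤ n) (hn : n ≤ q ^ 2)
    (hr : r ≤ q ^ 2) (hr₀ : r₀ = r ∨ 2 * r₀ ≤ r) (hE : E + q ^ 3 * r = q ^ 7 + q ^ 4 * r₀)
    (hvar : (q ^ 4 - n) ^ 2 ≤ (q - 1) * (E - n ^ 2)) :
    r = q ^ 2 ∧ r₀ = r ∧ 0 < n := by
  have hq2 : 0 < q ^ 2 := by positivity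
  have h1 : (q ^ 3 - n) ^ 2 ≤ (q - 1) * q ^ 2 * (q * r₀ - r) := by
    have : q * (q ^ 3 - n) ^ 2 ≤ q * ((q - 1) * q ^ 2 * (q * r₀ - r)) := by
      have : E = q ^ 7 + q ^ 4 * r₀ - q ^ 3 * r := by linarith
      subst this
      linarith
    exact le_of_mul_le_mul_left this (by linarith)
  have h2 : q ^ 2 * (q - 1) ≤ q * r₀ - r := by
    have h3 : q ^ 2 * (q - 1) ≤ q ^ 3 - n := by linarith
    have h4 : (q ^ 2 * (q - 1)) ^ 2 ≤ (q ^ 3 - n) ^ 2 :=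
      pow_le_pow_left₀ (mul_nonneg hq2.le (by linarith)) h3 2
    have h5 : ((q - 1) * q ^ 2) * (q ^ 2 * (q - 1)) ≤ ((q - 1) * q ^ 2) * (q * r₀ - r) := by
      linarith
    exact le_of_mul_le_mul_left h5 (mul_pos (by linarith) hq2)
  have h6 : r₀ = r := by
    refine hr₀.resolve_right fun h => ?_
    have h7 : q * (2 * r₀) ≤ q * r := mul_le_mul_of_nonneg_left h (by linarith)
    have h8 : (q - 2) * r ≤ (q - 2) * q ^ 2 := mul_le_mul_of_nonneg_left hr (by linarith)
    have h9 : 0 < q ^ 2 * q := by positivity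
    linarith
  subst h6
  have h7 : r₀ = q ^ 2 := by
    refine le_antisymm hr (le_of_mul_le_mul_left (a := q - 1) ?_ (by linarith))
    linarith
  refine ⟨h7, rfl, lt_of_le_of_ne hn₀ ?_⟩
  rintro rfl
  subst h7
  have h8 : 0 < q ^ 4 * (2 * q - 1) := mul_pos (by positivity) (by linarith)
  linarith

/-- If the affine part of `H ∩ Q` has at most `q²` points, then it is a coset of the radical, and
the radical has order `q²`. -/
theorem radical_of_card_zeros_le (hq : 2 < q) (hF : Fintype.card F = q ^ 2) (h2 : (2 : F) ≠ 0)
    (hadd : ∀ x y : F, (x + y) ^ q = x ^ q + y ^ q) (hinv : ∀ x : F, (x ^ q) ^ q = x)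
    (a b c d e f : F) (hA : #{v | affineEq q a b c d e f v = 0} ≤ q ^ 2) :
    #(radical q a b c) = q ^ 2 ∧ #{v | affineEq q a b c d e f v = 0} = q ^ 2 ∧
    ∀ v v', affineEq q a b c d e f v = 0 → affineEq q a b c d e f v' = 0 →
      v - v' ∈ radical q a b c := by
  set g := affineEq q a b c d e f with hg
  set R := radical q a b c with hR
  set R₀ := {u ∈ R | (d * u.1 + e * u.2) ^ q + (d * u.1 + e * u.2) = 0} with hR₀
  set K := ({x : F | x ^ q = x} : Finset F) with hK
  have hKcard : #K = q := (card_fixed_and_trace_fibre (by omega) hF hadd hinv).1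
  have h0K : (0 : F) ∈ K := by simp [hK, show q ≠ 0 by omega]
  have hRadd : ∀ u ∈ R, ∀ w ∈ R, u + w ∈ R := by
    intro u hu w hw
    simp only [hR, radical, mem_filter, mem_univ, true_and] at hu hw ⊢
    simp only [Prod.fst_add, Prod.snd_add, hadd, hu.1, hu.2, hw.1, hw.2]
    constructor <;> ring
  have hsub₀ : R₀ ⊆ R := filter_subset _ _
  have hdich : #R₀ = #R ∨ 2 * #R₀ ≤ #R := by
    by_cases h : R ⊆ R₀
    · exact Or.inl (congrArg card (hsub₀.antisymm h))
    · right
      obtain ⟨u, huR, hu⟩ := not_subset.1 h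
      have h1 : #(R₀.image (· + u)) = #R₀ := card_image_of_injective _ (add_left_injective u)
      have h3 : Disjoint R₀ (R₀.image (· + u)) := by
        rw [disjoint_left]
        intro w hw hw'
        obtain ⟨z, hz, rfl⟩ := mem_image.1 hw'
        apply hu
        simp only [hR₀, mem_filter, Prod.fst_add, Prod.snd_add, mul_add, hadd] at hw hz ⊢
        refine ⟨huR, ?_⟩
        linear_combination hw.2 - hz.2
      have h4 : R₀ ∪ R₀.image (· + u) ⊆ R := by
        apply union_subset hsub₀
        intro w hw
        obtain ⟨z, hz, rfl⟩ := mem_image.1 hw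
        exact hRadd _ (hsub₀ hz) _ huR
      have := card_le_card h4
      rw [card_union_of_disjoint h3, h1] at this
      omega
  have hE := sum_card_translate_eq (by omega) hF h2 hadd hinv a b c d e f
  rw [sum_sq_card_fibre hadd hinv, ← hg, ← hR, ← hR₀, ← hK] at hE
  have htot : ∑ k ∈ K, #{v | g v = k} = q ^ 4 := by
    have h1 : #(univ : Finset (F × F)) = q ^ 4 := by
      rw [card_univ, Fintype.card_prod, hF]; ring
    rw [← h1]
    symm
    apply card_eq_sum_card_fiberwise
    intro v _
    simpa [hK] using affineEq_fixed hadd hinv a b c d e f v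
  have hcs := sq_sum_le_card_mul_sum_sq (s := K.erase 0) (f := fun k => (#{v | g v = k} : ℤ))
  rw [cast_card_erase_of_mem h0K, hKcard] at hcs
  rw [← add_sum_erase K _ h0K] at htot hE
  have htot' : ∑ k ∈ K.erase 0, (#{v | g v = k} : ℤ) = (q : ℤ) ^ 4 - #{v | g v = 0} := by
    rw [eq_sub_iff_add_eq']
    exact_mod_cast htot
  rw [htot'] at hcs
  obtain ⟨h1, h3, h4⟩ := variance_bound (q := q) (n := #{v | g v = 0}) (r := #R) (r₀ := #R₀)
    (E := #{v | g v = 0} ^ 2 + ∑ k ∈ K.erase 0, (#{v | g v = k} : ℤ) ^ 2)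
    (by exact_mod_cast hq) (by positivity) (by exact_mod_cast hA)
    (by exact_mod_cast card_radical_le (by omega) hF a b c) (by exact_mod_cast hdich)
    (by exact_mod_cast hE) (by rw [add_sub_cancel_left]; exact hcs)
  have hRcard : #R = q ^ 2 := by exact_mod_cast h1
  have hReq : R₀ = R := eq_of_subset_of_card_le hsub₀ (by exact_mod_cast h3.ge)
  obtain ⟨p, hp⟩ := card_pos.1 (by exact_mod_cast h4 : 0 < #{v | g v = 0})
  have hp0 : g p = 0 := (mem_filter.1 hp).2
  have hsubA : R.image (p + ·) ⊆ ({v | g v = 0} : Finset (F × F)) := by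
    intro w hw
    obtain ⟨u, hu, rfl⟩ := mem_image.1 hw
    have hu₀ := (mem_filter.1 (hReq ▸ hu : u ∈ R₀)).2
    have hu' := (mem_filter.1 hu).2
    have ht := trace_form_eq_of_mem_radical h2 hadd hinv hu'.1 hu'.2
    simp only [mem_filter, mem_univ, true_and]
    rw [hg, affineEq_add hadd hinv, ← hg, hp0, ← hu'.1, ← hu'.2]
    simp only [hadd] at ht hu₀
    simp only [hg, affineEq, quadPoly, hadd, sub_self, zero_mul, zero_pow (show q ≠ 0 by omega)]
    linear_combination ht + hu₀
  have himg : #(R.image (p + ·)) = q ^ 2 := by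
    rw [card_image_of_injective _ (add_right_injective p), hRcard]
  have hAeq := eq_of_subset_of_card_le hsubA (by rw [himg]; exact hA)
  refine ⟨hRcard, by rw [← hAeq, himg], ?_⟩
  intro v v' hv hv'
  have hv₁ : v ∈ R.image (p + ·) := by rw [hAeq]; simpa using hv
  have hv₂ : v' ∈ R.image (p + ·) := by rw [hAeq]; simpa using hv'
  obtain ⟨u, hu, rfl⟩ := mem_image.1 hv₁
  obtain ⟨w, hw, rfl⟩ := mem_image.1 hv₂
  have hsub : ∀ x y : F, (x - y) ^ q = x ^ q - y ^ q := fun x y => by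
    have := hadd (x - y) y
    rw [sub_add_cancel] at this
    linear_combination -this
  simp only [hR, radical, mem_filter, mem_univ, true_and] at hu hw ⊢
  simp only [add_sub_add_left_eq_sub, Prod.fst_sub, Prod.snd_sub, hsub, hu.1, hu.2, hw.1, hw.2]
  constructor <;> ring

theorem isSquare_of_card_radical (hq : 1 < q) (hodd : Odd q) (hF : Fintype.card F = q ^ 2)
    (hadd : ∀ x y : F, (x + y) ^ q = x ^ q + y ^ q)
    (a b c : F) (hR : #(radical q a b c) = q ^ 2) :
    IsSquare (4 * a * b - c ^ 2) ∧ 4 * a * b - c ^ 2 ≠ 0 := by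
  have hsub : ∀ x y : F, (x - y) ^ q = x ^ q - y ^ q := fun x y => by
    have := hadd (x - y) y
    rw [sub_add_cancel] at this
    linear_combination -this
  have hRlt : q < #(radical q a b c) := by rw [hR]; nlinarith
  obtain ⟨v, hv, hv0⟩ := exists_mem_ne (hq.trans hRlt) (0 : F × F)
  have hv' := (mem_filter.1 hv).2
  obtain ⟨w, hw, hD⟩ : ∃ w ∈ radical q a b c, v.1 * w.2 - v.2 * w.1 ≠ 0 := by
    by_contra! hcon
    refine absurd hRlt (not_lt.2 ?_)
    refine le_trans ?_ (card_pow_eq_linear_le hq (1 : F) 0)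
    have hmul : ∀ w ∈ radical q a b c, ∃ t : F, w = (t * v.1, t * v.2) := by
      intro w hw
      have h := hcon w hw
      by_cases h1 : v.1 = 0
      · have h2 : v.2 ≠ 0 := fun h2 => hv0 (Prod.ext h1 h2)
        refine ⟨w.2 / v.2, Prod.ext ?_ ?_⟩
        · have : v.2 * w.1 = 0 := by rw [h1] at h; linear_combination -h
          simp [h1, (mul_eq_zero.1 this).resolve_left h2]
        · simp [h2]
      · refine ⟨w.1 / v.1, Prod.ext ?_ ?_⟩
        · simp [h1]
        · simp only
          field_simp
          linear_combination h
    have hsurj : radical q a b c ⊆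
        ({x : F | x ^ q = 1 * x + 0} : Finset F).image (fun t => (t * v.1, t * v.2)) := by
      intro w hw
      obtain ⟨t, rfl⟩ := hmul w hw
      have hw' := (mem_filter.1 hw).2
      refine mem_image.2 ⟨t, ?_, rfl⟩
      simp only [mem_filter, mem_univ, true_and, one_mul, add_zero]
      simp only [mul_pow] at hw'
      by_cases h1 : v.1 = 0
      · have h2 : v.2 ^ q ≠ 0 := pow_ne_zero _ fun h2 => hv0 (Prod.ext h1 h2)
        apply mul_right_cancel₀ h2
        linear_combination hw'.2 - t * hv'.2
      · apply mul_right_cancel₀ (pow_ne_zero q h1)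
        linear_combination hw'.1 - t * hv'.1
    exact (card_le_card hsurj).trans card_image_le
  have hw' := (mem_filter.1 hw).2
  set D := v.1 * w.2 - v.2 * w.1 with hDdef
  have hDq : D ^ q = (4 * a * b - c ^ 2) * D := by
    rw [hDdef, hsub, mul_pow, mul_pow, hv'.1, hv'.2, hw'.1, hw'.2]
    ring
  obtain ⟨m, rfl⟩ := hodd
  have hΔ : 4 * a * b - c ^ 2 = D ^ m * D ^ m := by
    apply mul_right_cancel₀ hD
    rw [← hDq]
    ring
  refine ⟨⟨D ^ m, hΔ⟩, ?_⟩
  rw [hΔ]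
  exact mul_ne_zero (pow_ne_zero _ hD) (pow_ne_zero _ hD)

end Counting

section Projective

variable {F : Type} [Field F] {q : ℕ} {a b c d e f : F}

theorem hermPt_smul {t : F} (ht : t ≠ 0) (v : Fin 4 → F) : hermPt q (t • v) ↔ hermPt q v := by
  have h : t ^ q * t ≠ 0 := mul_ne_zero (pow_ne_zero _ ht) ht
  simp only [hermPt, Pi.smul_apply, smul_eq_mul, mul_pow, pow_succ _ q]
  constructor
  · intro hv
    apply mul_left_cancel₀ h
    linear_combination hv
  · intro hv
    linear_combination (t ^ q * t) * hv

theorem quadForm_smul (t : F) (v : Fin 4 → F) :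
    quadForm a b c d e f (t • v) = t ^ 2 * quadForm a b c d e f v := by
  simp only [quadForm, Pi.smul_apply, smul_eq_mul]
  ring

theorem card_le_card_points [Fintype F] {ι : Type} (v : ι → Fin 4 → F)
    (hv₀ : ∀ i, v i ≠ 0) (hH : ∀ i, hermPt q (v i)) (hQ : ∀ i, quadForm a b c d e f (v i) = 0)
    (hinj : ∀ i j (t : F), t • v j = v i → i = j) :
    Nat.card ι ≤ Nat.card {P : Projectivization F (Fin 4 → F) //
        hermPt q P.rep ∧ quadForm a b c d e f P.rep = 0} := by
  have hmem : ∀ i, hermPt q (Projectivization.mk F (v i) (hv₀ i)).rep ∧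
      quadForm a b c d e f (Projectivization.mk F (v i) (hv₀ i)).rep = 0 := by
    intro i
    obtain ⟨t, ht⟩ := Projectivization.exists_smul_eq_mk_rep F (v i) (hv₀ i)
    rw [← ht, Units.smul_def, hermPt_smul t.ne_zero, quadForm_smul, hQ, mul_zero]
    exact ⟨hH i, rfl⟩
  have : Finite (Projectivization F (Fin 4 → F)) := Quotient.finite _
  refine Nat.card_le_card_of_injective (fun i => ⟨_, hmem i⟩) ?_
  intro i j hij
  obtain ⟨t, ht⟩ := (Projectivization.mk_eq_mk_iff' F _ _ (hv₀ i) (hv₀ j)).1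
    (congrArg Subtype.val hij)
  exact hinj i j t ht

theorem card_points_eq_one {W : Submodule F (Fin 4 → F)}
    (hW : ∀ v ∈ W, quadForm a b c d e f v = 0) {w : Fin 4 → F} (hw : w ∈ W) (hw₀ : w ≠ 0)
    (hH : hermPt q w) (huniq : ∀ v ∈ W, v ≠ 0 → hermPt q v → ∃ t : F, t • w = v) :
    Nat.card {P : Projectivization F (Fin 4 → F) //
        P.rep ∈ W ∧ hermPt q P.rep ∧ quadForm a b c d e f P.rep = 0} = 1 := by
  have key : ∀ P : Projectivization F (Fin 4 → F), P.rep ∈ W → hermPt q P.rep →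
      P = Projectivization.mk F w hw₀ := by
    intro P h1 h2
    rw [← P.mk_rep, Projectivization.mk_eq_mk_iff']
    exact huniq _ h1 P.rep_nonzero h2
  rw [Nat.card_eq_one_iff_unique]
  constructor
  · refine ⟨fun P P' => Subtype.ext ?_⟩
    rw [key P P.2.1 P.2.2.1, key P' P'.2.1 P'.2.2.1]
  · obtain ⟨t, ht⟩ := Projectivization.exists_smul_eq_mk_rep F w hw₀
    have hmem : (Projectivization.mk F w hw₀).rep ∈ W := ht ▸ W.smul_mem (t : F) hw
    refine ⟨⟨Projectivization.mk F w hw₀, hmem, ?_, hW _ hmem⟩⟩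
    rw [← ht, Units.smul_def, hermPt_smul t.ne_zero]
    exact hH

theorem quadForm_eq_zero_iff_of_one {v : Fin 4 → F} (hv : v 0 = 1) :
    quadForm a b c d e f v = 0 ↔ v 3 = quadPoly a b c d e f (v 1, v 2) := by
  simp only [quadForm, quadPoly, hv]
  constructor <;> intro h <;> linear_combination h

theorem hermPt_iff_affineEq {v : Fin 4 → F} (hv : v 0 = 1) (hQ : quadForm a b c d e f v = 0) :
    hermPt q v ↔ affineEq q a b c d e f (v 1, v 2) = 0 := by
  rw [quadForm_eq_zero_iff_of_one hv] at hQ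
  simp only [hermPt, affineEq, hv, hQ, one_pow, one_mul]
  constructor <;> intro h <;> linear_combination h

theorem card_zeros_le [Fintype F] [DecidableEq F] (hq : 0 < q)
    (hcard : Nat.card {P : Projectivization F (Fin 4 → F) //
        hermPt q P.rep ∧ quadForm a b c d e f P.rep = 0} = q ^ 2 + 1) :
    Finset.card {v | affineEq q a b c d e f v = 0} ≤ q ^ 2 := by
  let pt : Option {v // affineEq q a b c d e f v = 0} → Fin 4 → F := fun o =>
    o.elim ![0, 0, 0, 1] fun v => ![1, v.1.1, v.1.2, quadPoly a b c d e f v.1]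
  have hle := card_le_card_points (q := q) (a := a) (b := b) (c := c) (d := d) (e := e) (f := f) pt
    ?_ ?_ ?_ ?_
  · rw [hcard, Finite.card_option, Nat.card_eq_fintype_card, Fintype.card_subtype] at hle
    omega
  · rintro (_ | v) h
    · simpa [pt] using congrFun h 3
    · simpa [pt] using congrFun h 0
  · rintro (_ | v)
    · simp [pt, hermPt, hq.ne']
    · have hQ : quadForm a b c d e f (pt (some v)) = 0 :=
        (quadForm_eq_zero_iff_of_one rfl).2 rfl
      exact (hermPt_iff_affineEq rfl hQ).2 v.2
  · rintro (_ | v)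
    · simp [pt, quadForm]
    · exact (quadForm_eq_zero_iff_of_one rfl).2 rfl
  · rintro (_ | v) (_ | w) t h
    · rfl
    · have h0 := congrFun h 0
      have h3 := congrFun h 3
      simp [pt] at h0 h3
      simp [h0] at h3
    · simpa [pt] using congrFun h 0
    · have h0 := congrFun h 0
      have h1 := congrFun h 1
      have h2 := congrFun h 2
      simp [pt] at h0 h1 h2
      subst h0
      rw [one_mul] at h1 h2
      exact congrArg some (Subtype.ext (Prod.ext h1.symm h2.symm))

/-- If `H ∩ Q` has too few points, then `H` and `Q` share only `P` in the plane `j = 0`. -/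
theorem no_common_direction [Fintype F] [DecidableEq F] (hq : 1 < q)
    (hF : Fintype.card F = q ^ 2)
    (hA : Finset.card {v | affineEq q a b c d e f v = 0} = q ^ 2)
    (hcard : Nat.card {P : Projectivization F (Fin 4 → F) //
        hermPt q P.rep ∧ quadForm a b c d e f P.rep = 0} = q ^ 2 + 1)
    {x y : F} (hN : x ^ (q + 1) + y ^ (q + 1) = 0)
    (hB : a * x ^ 2 + b * y ^ 2 + c * x * y = 0) : x = 0 ∧ y = 0 := by
  by_contra hne
  have hxy : x ≠ 0 ∨ y ≠ 0 := by tauto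
  let pt : F ⊕ {v // affineEq q a b c d e f v = 0} → Fin 4 → F :=
    Sum.elim (fun z => ![0, x, y, z]) fun v => ![1, v.1.1, v.1.2, quadPoly a b c d e f v.1]
  have hle := card_le_card_points (q := q) (a := a) (b := b) (c := c) (d := d) (e := e) (f := f) pt
    ?_ ?_ ?_ ?_
  · rw [hcard, Nat.card_sum, Nat.card_eq_fintype_card, Nat.card_eq_fintype_card,
      Fintype.card_subtype, hF, hA] at hle
    nlinarith
  · rintro (z | v) h
    · exact hne ⟨by simpa [pt] using congrFun h 1, by simpa [pt] using congrFun h 2⟩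
    · simpa [pt] using congrFun h 0
  · rintro (z | v)
    · simp [pt, hermPt, hN, show q ≠ 0 by omega]
    · have hQ : quadForm a b c d e f (pt (.inr v)) = 0 :=
        (quadForm_eq_zero_iff_of_one rfl).2 rfl
      exact (hermPt_iff_affineEq rfl hQ).2 v.2
  · rintro (z | v)
    · simp [pt, quadForm]
      linear_combination -hB
    · exact (quadForm_eq_zero_iff_of_one rfl).2 rfl
  · rintro (z | v) (w | w) t h
    · have h1 : t * x = x := by simpa [pt] using congrFun h 1
      have h2 : t * y = y := by simpa [pt] using congrFun h 2
      have h3 : t * w = z := by simpa [pt] using congrFun h 3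
      have ht : t = 1 := by
        rcases hxy with h | h
        · exact mul_right_cancel₀ h (by rw [h1, one_mul])
        · exact mul_right_cancel₀ h (by rw [h2, one_mul])
      rw [ht, one_mul] at h3
      rw [h3]
    · have h0 := congrFun h 0
      have h1 := congrFun h 1
      have h2 := congrFun h 2
      simp [pt] at h0 h1 h2
      exact absurd ⟨by simpa [h0] using h1.symm, by simpa [h0] using h2.symm⟩ hne
    · simpa [pt] using congrFun h 0
    · have h0 := congrFun h 0
      have h1 := congrFun h 1
      have h2 := congrFun h 2
      simp [pt] at h0 h1 h2
      subst h0
      rw [one_mul] at h1 h2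
      exact congrArg Sum.inr (Subtype.ext (Prod.ext h1.symm h2.symm))

theorem vertex_mem_of_line_at_infinity (habc : ¬ (a = 0 ∧ b = 0 ∧ c = 0))
    {W : Submodule F (Fin 4 → F)} (hW2 : Module.finrank F W = 2)
    (hW : ∀ v ∈ W, quadForm a b c d e f v = 0) (hW0 : ∀ v ∈ W, v 0 = 0) :
    ![0, 0, 0, 1] ∈ W := by
  by_contra hP
  let π : W →ₗ[F] F × F :=
    ((LinearMap.proj 1).prod (LinearMap.proj 2)).comp W.subtype
  have hπ : ∀ w : W, π w = (w.1 1, w.1 2) := fun w => rfl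
  have hinj : Function.Injective π := by
    rw [← LinearMap.ker_eq_bot, LinearMap.ker_eq_bot']
    intro w hw
    rw [hπ, Prod.mk_eq_zero] at hw
    by_contra hne
    have h3 : w.1 3 ≠ 0 := by
      intro h3
      apply hne
      ext i
      fin_cases i
      · exact hW0 _ w.2
      · exact hw.1
      · exact hw.2
      · exact h3
    apply hP
    have : (![0, 0, 0, 1] : Fin 4 → F) = (w.1 3)⁻¹ • w.1 := by
      ext i
      fin_cases i
      · simp [hW0 _ w.2]
      · simp [hw.1]
      · simp [hw.2]
      · simp [h3]
    rw [this]
    exact W.smul_mem _ w.2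
  have hsurj : Function.Surjective π :=
    (LinearMap.injective_iff_surjective_of_finrank_eq_finrank (by simp [hW2])).1 hinj
  have hB : ∀ x y : F, a * x ^ 2 + b * y ^ 2 + c * x * y = 0 := by
    intro x y
    obtain ⟨w, hw⟩ := hsurj (x, y)
    rw [hπ, Prod.mk_inj] at hw
    have := hW _ w.2
    rw [quadForm, hW0 _ w.2, hw.1, hw.2] at this
    linear_combination -this
  have ha : a = 0 := by simpa using hB 1 0
  have hb : b = 0 := by simpa using hB 0 1
  exact habc ⟨ha, hb, by simpa [ha, hb] using hB 1 1⟩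

theorem exists_pair_of_functional {V : Type*} [AddCommGroup V] [Module F V]
    (hV : Module.finrank F V = 2) {π : V →ₗ[F] F} (hπ : π ≠ 0) :
    ∃ w u : V, π w = 1 ∧ π u = 0 ∧ u ≠ 0 ∧ ∀ v, ∃ s : F, v = π v • w + s • u := by
  have hsurj : Function.Surjective π := LinearMap.surjective hπ
  have : Module.Finite F V := Module.finite_of_finrank_pos (by omega)
  have hker : Module.finrank F (LinearMap.ker π) = 1 := by
    have := LinearMap.finrank_range_add_finrank_ker π
    rw [LinearMap.range_eq_top.2 hsurj, finrank_top, Module.finrank_self, hV] at this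
    omega
  obtain ⟨u, hu, hspan⟩ := finrank_eq_one_iff'.1 hker
  obtain ⟨w, hw⟩ := hsurj 1
  refine ⟨w, u, hw, u.2, fun h => hu (Subtype.ext h), fun v => ?_⟩
  have hmem : v - π v • w ∈ LinearMap.ker π := by
    rw [LinearMap.mem_ker, map_sub, map_smul, hw, smul_eq_mul, mul_one, sub_self]
  obtain ⟨s, hs⟩ := hspan ⟨_, hmem⟩
  refine ⟨s, ?_⟩
  have h : s • (u : V) = v - π v • w := congrArg Subtype.val hs
  rw [h, add_sub_cancel]

/-- A two-dimensional subspace not contained in the hyperplane `j = 0` has a basis consisting of a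
vector with first coordinate `1` and a vector with first coordinate `0`. -/
theorem exists_affine_basis {W : Submodule F (Fin 4 → F)} (hW2 : Module.finrank F W = 2)
    {v₀ : Fin 4 → F} (hv₀ : v₀ ∈ W) (hv₀0 : v₀ 0 ≠ 0) :
    ∃ w ∈ W, ∃ u ∈ W, w 0 = 1 ∧ u 0 = 0 ∧ u ≠ 0 ∧ ∀ v ∈ W, ∃ s : F, v = v 0 • w + s • u := by
  obtain ⟨w, u, hw, hu, hu0, hspan⟩ := exists_pair_of_functional hW2
    (π := (LinearMap.proj 0).comp W.subtype) fun h => hv₀0 (LinearMap.congr_fun h ⟨v₀, hv₀⟩)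
  refine ⟨w, w.2, u, u.2, hw, hu, fun h => hu0 (Subtype.ext h), fun v hv => ?_⟩
  obtain ⟨s, hs⟩ := hspan ⟨v, hv⟩
  exact ⟨s, congrArg Subtype.val hs⟩

/-- An isotropic direction that is not a common direction of `H` and `Q` is a complement of the
radical, so every affine line in this direction meets each coset of the radical once. -/
theorem existsUnique_affineEq_on_line [Fintype F] [DecidableEq F] (hF : Fintype.card F = q ^ 2)
    (h2 : (2 : F) ≠ 0) (hq : 0 < q) (hadd : ∀ x y : F, (x + y) ^ q = x ^ q + y ^ q)
    (hinv : ∀ x : F, (x ^ q) ^ q = x)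
    (hA : Finset.card {v | affineEq q a b c d e f v = 0} = q ^ 2)
    (hcoset : ∀ v v', affineEq q a b c d e f v = 0 → affineEq q a b c d e f v' = 0 →
      v - v' ∈ radical q a b c)
    {x y : F} (hB : a * x ^ 2 + b * y ^ 2 + c * x * y = 0)
    (hN : x ^ (q + 1) + y ^ (q + 1) ≠ 0) (w : F × F) :
    ∃! t : F, affineEq q a b c d e f (w + t • (x, y)) = 0 := by
  have hdisj : ∀ t : F, t • (x, y) ∈ radical q a b c → t = 0 := by
    intro t ht
    simp only [radical, Finset.mem_filter, Finset.mem_univ, true_and, Prod.smul_mk,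
      smul_eq_mul] at ht
    have h := trace_form_eq_of_mem_radical h2 hadd hinv ht.1 ht.2
    have h0 : a * (t * x) ^ 2 + b * (t * y) ^ 2 + c * (t * x) * (t * y) = 0 := by
      linear_combination t ^ 2 * hB
    rw [h0, zero_pow hq.ne', add_zero, mul_pow, mul_pow, ← mul_add] at h
    exact pow_eq_zero_iff (Nat.succ_ne_zero q) |>.1 ((mul_eq_zero.1 h.symm).resolve_right hN)
  have huniq : ∀ t t' : F, affineEq q a b c d e f (w + t • (x, y)) = 0 →
      affineEq q a b c d e f (w + t' • (x, y)) = 0 → t = t' := by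
    intro t t' h h'
    have := hcoset _ _ h h'
    rw [add_sub_add_left_eq_sub, ← sub_smul] at this
    exact sub_eq_zero.1 (hdisj _ this)
  let ψ : F × {v // affineEq q a b c d e f v = 0} → F × F := fun p => p.2.1 - p.1 • (x, y)
  have hψ : Function.Injective ψ := by
    rintro ⟨t, v, hv⟩ ⟨t', v', hv'⟩ h
    have h : v - t • (x, y) = v' - t' • (x, y) := h
    have h1 : v - v' = (t - t') • (x, y) := by
      rw [sub_smul, sub_eq_sub_iff_add_eq_add]
      rw [sub_eq_sub_iff_add_eq_add] at h
      rw [h, add_comm]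
    have h3 := hdisj _ (h1 ▸ hcoset _ _ hv hv')
    rw [h3, zero_smul, sub_eq_zero] at h1
    rw [sub_eq_zero] at h3
    subst h1 h3
    rfl
  have hbij : Function.Bijective ψ := by
    rw [Fintype.bijective_iff_injective_and_card]
    refine ⟨hψ, ?_⟩
    rw [Fintype.card_prod, Fintype.card_prod, Fintype.card_subtype, hA, hF]
  obtain ⟨⟨t, v, hv⟩, h⟩ := hbij.2 w
  have h : v - t • (x, y) = w := h
  refine ⟨t, ?_, fun t' ht' => huniq _ _ ht' ?_⟩ <;>
  · simp only [← h, sub_add_cancel, hv]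

end Projective

theorem minimal_intersection_is_ovoid
    (q : ℕ) (hq : ∃ p n : ℕ, p.Prime ∧ Odd p ∧ 0 < n ∧ q = p ^ n)
    (F : Type) [Field F] [Fintype F] (hF : Fintype.card F = q ^ 2)
    (a b c d e f : F) (habc : ¬ (a = 0 ∧ b = 0 ∧ c = 0))
    (hcard : Nat.card {P : Projectivization F (Fin 4 → F) //
        hermPt q P.rep ∧ quadForm a b c d e f P.rep = 0} = q ^ 2 + 1) :
    (IsSquare (4 * a * b - c ^ 2) ∧ 4 * a * b - c ^ 2 ≠ 0) ∧
    ∀ W : Submodule F (Fin 4 → F), Module.finrank F W = 2 →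
      (∀ v ∈ W, quadForm a b c d e f v = 0) →
      Nat.card {P : Projectivization F (Fin 4 → F) //
          P.rep ∈ W ∧ hermPt q P.rep ∧ quadForm a b c d e f P.rep = 0} = 1 := by
  classical
  obtain ⟨p, n, hp, hpodd, hn, hqp⟩ := hq
  have : Fact p.Prime := ⟨hp⟩
  have hodd : Odd q := hqp ▸ hpodd.pow
  have hq1 : 1 < q := hqp ▸ Nat.one_lt_pow hn.ne' hp.one_lt
  have hq2 : 2 < q := by
    obtain ⟨m, hm⟩ := hodd
    omega
  have : CharP F p := by
    refine charP_of_card_eq_prime_pow (f := n * 2) ?_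
    rw [hF, hqp, pow_mul]
  have h2 : (2 : F) ≠ 0 := by
    intro h
    have : p ∣ 2 := (CharP.cast_eq_zero_iff F p 2).1 (by exact_mod_cast h)
    have := (Nat.prime_dvd_prime_iff_eq hp Nat.prime_two).1 this
    subst this
    exact absurd hpodd (by decide)
  have hadd : ∀ x y : F, (x + y) ^ q = x ^ q + y ^ q := fun x y => by
    rw [hqp]
    exact add_pow_char_pow x y p n
  have hinv : ∀ x : F, (x ^ q) ^ q = x := fun x => by
    rw [← pow_mul, ← sq, ← hF]
    exact FiniteField.pow_card x
  obtain ⟨hR, hA, hcoset⟩ := radical_of_card_zeros_le hq2 hF h2 hadd hinv a b c d e f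
    (card_zeros_le (by omega) hcard)
  refine ⟨isSquare_of_card_radical hq1 hodd hF hadd a b c hR, ?_⟩
  intro W hW2 hW
  have hdir : ∀ x y : F, x ^ (q + 1) + y ^ (q + 1) = 0 →
      a * x ^ 2 + b * y ^ 2 + c * x * y = 0 → x = 0 ∧ y = 0 :=
    fun x y => no_common_direction hq1 hF hA hcard
  have hinf : ∀ v ∈ W, v 0 = 0 → a * v 1 ^ 2 + b * v 2 ^ 2 + c * v 1 * v 2 = 0 := by
    intro v hv hv0
    have := hW v hv
    rw [quadForm, hv0] at this
    linear_combination -this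
  have hinfH : ∀ v ∈ W, v 0 = 0 → hermPt q v → v 1 = 0 ∧ v 2 = 0 := by
    intro v hv hv0 hH
    refine hdir _ _ ?_ (hinf v hv hv0)
    rw [hermPt, hv0, zero_pow (by omega), zero_mul, zero_mul, zero_add] at hH
    exact hH.symm
  by_cases hW0 : ∀ v ∈ W, v 0 = 0
  · refine card_points_eq_one hW (vertex_mem_of_line_at_infinity habc hW2 hW hW0) ?_ ?_ ?_
    · intro h
      simpa using congrFun h 3
    · simp [hermPt, show q ≠ 0 by omega]
    · intro v hv _ hH
      obtain ⟨h1, h3⟩ := hinfH v hv (hW0 v hv) hH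
      refine ⟨v 3, ?_⟩
      ext i
      fin_cases i <;> simp [h1, h3, hW0 v hv]
  · push Not at hW0
    obtain ⟨v₀, hv₀, hv₀0⟩ := hW0
    obtain ⟨w, hw, u, huW, hw0, hu0, hu, hspan⟩ := exists_affine_basis hW2 hv₀ hv₀0
    have hQu := hinf u huW hu0
    have hNu : u 1 ^ (q + 1) + u 2 ^ (q + 1) ≠ 0 := by
      intro hN
      obtain ⟨h1, h3⟩ := hdir _ _ hN hQu
      apply hu
      have h4 := hW _ (W.add_mem hw huW)
      have h5 := hW _ hw
      simp only [quadForm, Pi.add_apply, hw0, hu0, h1, h3] at h4 h5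
      have h6 : u 3 = 0 := by linear_combination h4 - h5
      ext i
      fin_cases i <;> assumption
    obtain ⟨t, ht, htuniq⟩ := existsUnique_affineEq_on_line hF h2 (by omega) hadd hinv hA hcoset
      hQu hNu (w 1, w 2)
    have hline : ∀ s : F, hermPt q (w + s • u) ↔
        affineEq q a b c d e f ((w 1, w 2) + s • (u 1, u 2)) = 0 := fun s =>
      hermPt_iff_affineEq (by simp [hw0, hu0]) (hW _ (W.add_mem hw (W.smul_mem s huW)))
    refine card_points_eq_one hW (W.add_mem hw (W.smul_mem t huW)) ?_ ((hline t).2 ht) ?_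
    · intro h
      simpa [hw0, hu0] using congrFun h 0
    · intro v hv hvne hH
      obtain ⟨s, hs⟩ := hspan v hv
      have hv0 : v 0 ≠ 0 := by
        intro hv0
        obtain ⟨h1, h3⟩ := hinfH v hv hv0 hH
        rw [hv0, zero_smul, zero_add] at hs
        have hs0 : s = 0 := by
          by_contra hs0
          apply hNu
          rw [hs] at h1 h3
          simp only [Pi.smul_apply, smul_eq_mul, mul_eq_zero, hs0, false_or] at h1 h3
          simp [h1, h3]
        exact hvne (by rw [hs, hs0, zero_smul])
      have hs' : v = v 0 • (w + (s / v 0) • u) := by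
        rw [smul_add, smul_smul, mul_div_cancel₀ _ hv0]
        exact hs
      refine ⟨v 0, ?_⟩
      rw [hs', hermPt_smul hv0, hline] at hH
      rw [← htuniq _ hH]
      exact hs'.symm
end

section
/- Suppose (a,b,c) ≠ (0,0,0) and the number of points of PG(3,q²) lying on both H and Q is exactly q² + 1. Then Ω = H ∩ Q is contained in a Baer subgeometry PG(3,q) of PG(3,q²): there exists an invertible F-linear map g of F⁴ such that every point of Ω has a representative vector v ∈ F⁴ with all four coordinates of g·v lying in the subfield GF(q) of F. -/
/-- The quadric `Q`. -/
def quadPt {F : Type} [Field F] (a b c d e f : F) (v : Fin 4 → F) : Prop :=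
  v 0 * v 3 =
    a * (v 1) ^ 2 + b * (v 2) ^ 2 + c * (v 1) * (v 2) +
      d * (v 1) * (v 0) + e * (v 2) * (v 0) + f * (v 0) ^ 2

open Finset in
/-- A trinomial `x ^ q + u * x + k` with `2 ≤ q` has at most `q` roots. -/
theorem card_trinomial_roots_le {F : Type*} [Field F] [Fintype F] [DecidableEq F]
    {q : ℕ} (hq : 2 ≤ q) (u k : F) :
    #{x : F | x ^ q + u * x + k = 0} ≤ q := by
  classical
  let P : Polynomial F :=
    Polynomial.X ^ q + (Polynomial.C u * Polynomial.X + Polynomial.C k)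
  have hlow : (Polynomial.C u * Polynomial.X + Polynomial.C k).degree < (q : WithBot ℕ) :=
    lt_of_le_of_lt Polynomial.degree_linear_le (by exact_mod_cast hq)
  have hmonic : P.Monic := Polynomial.monic_X_pow_add hlow
  have hdeg : P.natDegree = q := by
    apply Polynomial.natDegree_eq_of_degree_eq_some
    rw [Polynomial.degree_add_eq_left_of_degree_lt] <;> rw [Polynomial.degree_X_pow]
    exact hlow
  calc #{x : F | x ^ q + u * x + k = 0} ≤ #P.roots.toFinset := by
        apply card_le_card
        intro x hx
        rw [mem_filter] at hx
        rw [Multiset.mem_toFinset, Polynomial.mem_roots hmonic.ne_zero]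
        simpa [P, add_assoc] using hx.2
    _ ≤ P.roots.card := Multiset.toFinset_card_le _
    _ ≤ q := hdeg ▸ Polynomial.card_roots' P

open Finset in
/-- A second moment bound for the fibres of a function on an abelian group of order `q ^ 4`, in
terms of the group of its periods. -/
theorem second_moment_periods {V F : Type*} [AddCommGroup V] [Fintype V] [Zero F]
    [DecidableEq F] {q : ℕ} (hV : Fintype.card V = q ^ 4) (f : V → F) (K : Finset F)
    (hf : ∀ v, f v ∈ K) (h0 : (0 : F) ∈ K) (hK : #K ≤ q)
    (hw : ∀ w, (¬ ∀ v, f (v + w) = f v) → #{v | f (v + w) = f v} ≤ q ^ 3) :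
    ((q : ℤ) ^ 4 - #{v | f v = 0}) ^ 2 ≤
      (q - 1) * (q ^ 7 + #{w | ∀ v, f (v + w) = f v} * ((q : ℤ) ^ 4 - q ^ 3)
        - (#{v | f v = 0} : ℤ) ^ 2) := by
  classical
  set r := #{w | ∀ v, f (v + w) = f v} with hr
  let N : F → ℕ := fun s => #{v | f v = s}
  have hsum : ∑ s ∈ K, N s = q ^ 4 := by
    rw [← hV, ← card_univ]
    exact (card_eq_sum_card_fiberwise fun v _ => hf v).symm
  have hsq : ∑ s ∈ K, (N s) ^ 2 = ∑ w : V, #{v | f (v + w) = f v} := by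
    have h1 : ∀ w : V, #{v | f (v + w) = f v} = ∑ v, if f (v + w) = f v then 1 else 0 := by
      intro w; rw [card_filter]
    have h2 : ∀ v : V, (∑ w, if f (v + w) = f v then 1 else 0) = N (f v) := by
      intro v
      rw [← card_filter]
      exact card_bij (fun w _ => v + w) (by simp) (by simp)
        (fun b hb => ⟨b - v, by simpa using hb, by simp⟩)
    simp_rw [h1]
    rw [sum_comm]
    simp_rw [h2]
    rw [← sum_fiberwise_of_maps_to (s := univ) (t := K) (g := f) fun v _ => hf v]
    refine sum_congr rfl fun s _ => ?_
    rw [sum_congr rfl (g := fun _ => N s) (fun v hv => by rw [(mem_filter.1 hv).2])]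
    simp [N, sq]
  have hupper : (∑ w : V, (#{v | f (v + w) = f v} : ℤ)) ≤
      q ^ 7 + r * ((q : ℤ) ^ 4 - q ^ 3) := by
    have hle : ∀ w : V, (#{v | f (v + w) = f v} : ℤ) ≤
        q ^ 3 + if (∀ v, f (v + w) = f v) then ((q : ℤ) ^ 4 - q ^ 3) else 0 := by
      intro w
      split_ifs with h
      · have : #{v | f (v + w) = f v} ≤ q ^ 4 := hV ▸ card_le_univ _
        have : (#{v | f (v + w) = f v} : ℤ) ≤ (q : ℤ) ^ 4 := by exact_mod_cast this
        linarith
      · have := hw w h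
        rw [add_zero]
        exact_mod_cast this
    refine (sum_le_sum fun w _ => hle w).trans (le_of_eq ?_)
    rw [sum_add_distrib, sum_const, card_univ, hV, ← sum_filter, sum_const, nsmul_eq_mul,
      nsmul_eq_mul]
    push_cast
    ring
  have hsplit1 : (∑ s ∈ K.erase 0, (N s : ℤ)) = (q : ℤ) ^ 4 - N 0 := by
    have := add_sum_erase K (fun s => (N s : ℤ)) h0
    have h' : (∑ s ∈ K, (N s : ℤ)) = (q : ℤ) ^ 4 := by exact_mod_cast hsum
    linarith
  have hsplit2 : (∑ s ∈ K.erase 0, (N s : ℤ) ^ 2) ≤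
      q ^ 7 + r * ((q : ℤ) ^ 4 - q ^ 3) - (N 0 : ℤ) ^ 2 := by
    have := add_sum_erase K (fun s => (N s : ℤ) ^ 2) h0
    have h' : (∑ s ∈ K, (N s : ℤ) ^ 2) = ∑ w : V, (#{v | f (v + w) = f v} : ℤ) := by
      exact_mod_cast hsq
    linarith
  have hcard : (#(K.erase 0) : ℤ) ≤ q - 1 := by
    have := card_erase_add_one h0
    have : #(K.erase 0) + 1 ≤ q := by omega
    have : (#(K.erase 0) : ℤ) + 1 ≤ q := by exact_mod_cast this
    linarith
  have hnn : 0 ≤ ∑ s ∈ K.erase 0, (N s : ℤ) ^ 2 := sum_nonneg fun _ _ => sq_nonneg _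
  calc ((q : ℤ) ^ 4 - N 0) ^ 2 = (∑ s ∈ K.erase 0, (N s : ℤ)) ^ 2 := by rw [hsplit1]
    _ ≤ #(K.erase 0) * ∑ s ∈ K.erase 0, (N s : ℤ) ^ 2 := sq_sum_le_card_mul_sum_sq
    _ ≤ (q - 1) * ∑ s ∈ K.erase 0, (N s : ℤ) ^ 2 := mul_le_mul_of_nonneg_right hcard hnn
    _ ≤ _ := mul_le_mul_of_nonneg_left hsplit2 (le_trans (by positivity) hcard)

open Finset in
/-- The solution set of `A w = σ w` in `F²`, where `σ x = x ^ q`, is contained in a `GF(q)`-plane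
spanned by an `F`-basis as soon as it has at least `q ^ 2` elements, and it never has more. -/
theorem semilinear_fixed_plane {F : Type*} [Field F] [Fintype F] [DecidableEq F] {q : ℕ}
    (hq : 2 ≤ q) (σ : F →+* F) (hσ : ∀ x, σ x = x ^ q) (α β γ δ : F) (R : Finset (F × F))
    (hR : ∀ w ∈ R, α * w.1 + β * w.2 = σ w.1 ∧ γ * w.1 + δ * w.2 = σ w.2) :
    #R ≤ q ^ 2 ∧ (q ^ 2 ≤ #R → ∃ u ∈ R, ∃ v ∈ R, u.1 * v.2 - u.2 * v.1 ≠ 0 ∧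
      ∀ w ∈ R, ∃ s t : F, σ s = s ∧ σ t = t ∧
        w.1 = s * u.1 + t * v.1 ∧ w.2 = s * u.2 + t * v.2) := by
  classical
  let K : Finset F := {x | σ x = x}
  have hK : #K ≤ q := by
    refine le_trans (card_le_card fun x hx => ?_) (card_trinomial_roots_le hq (-1 : F) 0)
    rw [mem_filter] at hx ⊢
    exact ⟨mem_univ _, by rw [← hσ, hx.2]; ring⟩
  have hqq : q < q ^ 2 := by nlinarith
  have hspan : ∀ u ∈ R, ∀ v ∈ R, u.1 * v.2 - u.2 * v.1 ≠ 0 →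
      ∀ w ∈ R, ∃ s t : F, σ s = s ∧ σ t = t ∧
        w.1 = s * u.1 + t * v.1 ∧ w.2 = s * u.2 + t * v.2 := by
    intro u hu v hv hD w hw
    obtain ⟨hu1, hu2⟩ := hR u hu
    obtain ⟨hv1, hv2⟩ := hR v hv
    obtain ⟨hw1, hw2⟩ := hR w hw
    set D := u.1 * v.2 - u.2 * v.1 with hDdef
    have hσD : σ D ≠ 0 := (map_ne_zero σ).2 hD
    set s := (w.1 * v.2 - w.2 * v.1) / D with hs
    set t := (u.1 * w.2 - u.2 * w.1) / D with ht
    have e1 : w.1 = s * u.1 + t * v.1 := by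
      rw [hs, ht]; field_simp; rw [hDdef]; ring
    have e2 : w.2 = s * u.2 + t * v.2 := by
      rw [hs, ht]; field_simp; rw [hDdef]; ring
    have f1 : σ w.1 = σ s * σ u.1 + σ t * σ v.1 := by rw [e1]; simp
    have f2 : σ w.2 = σ s * σ u.2 + σ t * σ v.2 := by rw [e2]; simp
    have g1 : σ w.1 = s * σ u.1 + t * σ v.1 := by
      rw [← hw1, ← hu1, ← hv1, e1, e2]; ring
    have g2 : σ w.2 = s * σ u.2 + t * σ v.2 := by
      rw [← hw2, ← hu2, ← hv2, e1, e2]; ring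
    have hσD' : σ D = σ u.1 * σ v.2 - σ u.2 * σ v.1 := by rw [hDdef]; simp
    refine ⟨s, t, ?_, ?_, e1, e2⟩
    · apply mul_right_cancel₀ hσD
      rw [hσD']
      linear_combination (g1 - f1) * σ v.2 - (g2 - f2) * σ v.1
    · apply mul_right_cancel₀ hσD
      rw [hσD']
      linear_combination (g2 - f2) * σ u.1 - (g1 - f1) * σ u.2
  by_cases hex : ∃ u ∈ R, ∃ v ∈ R, u.1 * v.2 - u.2 * v.1 ≠ 0
  · obtain ⟨u, hu, v, hv, hD⟩ := hex
    refine ⟨?_, fun _ => ⟨u, hu, v, hv, hD, hspan u hu v hv hD⟩⟩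
    calc #R ≤ #((K ×ˢ K).image fun p => (p.1 * u.1 + p.2 * v.1, p.1 * u.2 + p.2 * v.2)) := by
          apply card_le_card
          intro w hw
          obtain ⟨s, t, hs, ht, e1, e2⟩ := hspan u hu v hv hD w hw
          rw [mem_image]
          exact ⟨(s, t), by simp [K, hs, ht], Prod.ext e1.symm e2.symm⟩
      _ ≤ #(K ×ˢ K) := card_image_le
      _ ≤ q ^ 2 := by rw [card_product, sq]; exact Nat.mul_le_mul hK hK
  · push Not at hex
    have hsmall : #R ≤ q := by
      by_cases hz : ∃ u ∈ R, u ≠ 0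
      · obtain ⟨u, hu, hu0⟩ := hz
        refine le_trans (card_le_card (t := K.image fun l => (l * u.1, l * u.2)) ?_)
          (card_image_le.trans hK)
        intro w hw
        have hd := hex u hu w hw
        obtain ⟨hu1, hu2⟩ := hR u hu
        obtain ⟨hw1, hw2⟩ := hR w hw
        have hl : ∃ l, w.1 = l * u.1 ∧ w.2 = l * u.2 := by
          by_cases h1 : u.1 = 0
          · have h2 : u.2 ≠ 0 := fun h2 => hu0 (Prod.ext h1 h2)
            refine ⟨w.2 / u.2, ?_, by field_simp⟩
            field_simp
            linear_combination -hd
          · refine ⟨w.1 / u.1, by field_simp, ?_⟩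
            field_simp
            linear_combination hd
        obtain ⟨l, e1, e2⟩ := hl
        have k1 : (σ l - l) * σ u.1 = 0 := by
          rw [e1, e2, map_mul] at hw1
          linear_combination l * hu1 - hw1
        have k2 : (σ l - l) * σ u.2 = 0 := by
          rw [e1, e2, map_mul] at hw2
          linear_combination l * hu2 - hw2
        have hl : σ l = l := by
          by_contra hne
          have hne' : σ l - l ≠ 0 := sub_ne_zero.2 hne
          have k1' := (map_eq_zero σ).1 ((mul_eq_zero.1 k1).resolve_left hne')
          have k2' := (map_eq_zero σ).1 ((mul_eq_zero.1 k2).resolve_left hne')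
          exact hu0 (Prod.ext k1' k2')
        rw [mem_image]
        exact ⟨l, by simp [K, hl], Prod.ext e1.symm e2.symm⟩
      · push Not at hz
        have : R ⊆ {0} := fun w hw => mem_singleton.2 (hz w hw)
        have := card_le_card this
        rw [card_singleton] at this
        omega
    exact ⟨hsmall.trans hqq.le, fun h => absurd (h.trans hsmall) (not_le.2 hqq)⟩

open Finset in
/-- The zeros in `F²` of `Tr (Q x y) - N x - N y`, with `Q` quadratic and `Tr`, `N` the trace and norm
down to `GF(q)`: their number is nonzero, and if it is `q ^ 2` then they form a coset of
a `GF(q)`-plane. -/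
theorem hermitian_quadric_affine_part {F : Type*} [Field F] [Fintype F] [DecidableEq F] {q : ℕ}
    (hq : 3 ≤ q) (hF : Fintype.card F = q ^ 2) (σ : F →+* F) (hσ : ∀ x, σ x = x ^ q)
    (a b c d e f : F) (Q p : F × F → F)
    (hQ : ∀ v, Q v = a * v.1 ^ 2 + b * v.2 ^ 2 + c * v.1 * v.2 + d * v.1 + e * v.2 + f)
    (hp : ∀ v, p v = Q v + σ (Q v) - v.1 * σ v.1 - v.2 * σ v.2) :
    #{v | p v = 0} ≠ 0 ∧ (#{v | p v = 0} = q ^ 2 →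
      ∃ o u₁ u₂ : F × F, u₁.1 * u₂.2 - u₁.2 * u₂.1 ≠ 0 ∧
        ∀ v, p v = 0 → ∃ w : F × F, ∃ s t : F, v = o + w ∧ σ s = s ∧ σ t = t ∧
          w.1 = s * u₁.1 + t * u₂.1 ∧ w.2 = s * u₁.2 + t * u₂.2 ∧
          2 * a * w.1 + c * w.2 = σ w.1 ∧ c * w.1 + 2 * b * w.2 = σ w.2) := by
  classical
  have hσσ : ∀ x, σ (σ x) = x := fun x => by
    rw [hσ, hσ, ← pow_mul, ← sq, ← hF, FiniteField.pow_card]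
  have hdiff : ∀ v w : F × F, p (v + w) - p v = p w - p 0 +
      ((v.1 * (2 * a * w.1 + c * w.2 - σ w.1) + v.2 * (c * w.1 + 2 * b * w.2 - σ w.2)) +
        σ (v.1 * (2 * a * w.1 + c * w.2 - σ w.1) + v.2 * (c * w.1 + 2 * b * w.2 - σ w.2))) := by
    intro v w
    simp only [hp, hQ, Prod.fst_add, Prod.snd_add, Prod.fst_zero, Prod.snd_zero, map_add, map_sub,
      map_mul, map_pow, map_zero, hσσ, map_ofNat]
    ring
  have htrace : ∀ m k : F, m ≠ 0 → #{x : F | m * x + σ (m * x) = k} ≤ q := by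
    intro m k hm
    refine le_trans ?_ (card_trinomial_roots_le (F := F) (q := q) (by omega) 1 (-k))
    refine card_le_card_of_injOn (fun x => m * x) ?_ (fun x _ y _ h => mul_left_cancel₀ hm h)
    intro x hx
    simp only [coe_filter, mem_univ, true_and, Set.mem_ofPred_eq] at hx ⊢
    rw [← hσ]
    linear_combination hx
  have htrace2 : ∀ m₁ m₂ k : F, ¬ (m₁ = 0 ∧ m₂ = 0) →
      #{v : F × F | (v.1 * m₁ + v.2 * m₂) + σ (v.1 * m₁ + v.2 * m₂) = k} ≤ q ^ 3 := by
    intro m₁ m₂ k hm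
    have hcF : #(univ : Finset F) = q ^ 2 := by rw [card_univ, hF]
    by_cases h1 : m₁ = 0
    · have h2 : m₂ ≠ 0 := fun h2 => hm ⟨h1, h2⟩
      refine (card_le_mul_card_image_of_maps_to (f := Prod.fst) (t := univ)
        (fun _ _ => mem_univ _) q fun x _ => ?_).trans (by rw [hcF]; exact le_of_eq (by ring))
      refine le_trans ?_ (htrace m₂ (k - x * m₁ - σ (x * m₁)) h2)
      refine card_le_card_of_injOn Prod.snd ?_ ?_
      · intro v hv
        simp only [coe_filter, mem_filter, mem_univ, true_and, Set.mem_ofPred_eq] at hv ⊢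
        obtain ⟨hv, rfl⟩ := hv
        rw [map_add] at hv
        rw [mul_comm m₂]
        linear_combination hv
      · intro v hv w hw h
        simp only [coe_filter, mem_filter, mem_univ, true_and, Set.mem_ofPred_eq] at hv hw
        exact Prod.ext (hv.2.trans hw.2.symm) h
    · refine (card_le_mul_card_image_of_maps_to (f := Prod.snd) (t := univ)
        (fun _ _ => mem_univ _) q fun x _ => ?_).trans (by rw [hcF]; exact le_of_eq (by ring))
      refine le_trans ?_ (htrace m₁ (k - x * m₂ - σ (x * m₂)) h1)
      refine card_le_card_of_injOn Prod.fst ?_ ?_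
      · intro v hv
        simp only [coe_filter, mem_filter, mem_univ, true_and, Set.mem_ofPred_eq] at hv ⊢
        obtain ⟨hv, rfl⟩ := hv
        rw [map_add] at hv
        rw [mul_comm m₁]
        linear_combination hv
      · intro v hv w hw h
        simp only [coe_filter, mem_filter, mem_univ, true_and, Set.mem_ofPred_eq] at hv hw
        exact Prod.ext h (hv.2.trans hw.2.symm)
  let R : Finset (F × F) := {w | ∀ v, p (v + w) = p v}
  have hRmem : ∀ w ∈ R, 2 * a * w.1 + c * w.2 = σ w.1 ∧ c * w.1 + 2 * b * w.2 = σ w.2 := by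
    intro w hw
    rw [mem_filter] at hw
    by_contra hcon
    have hle := htrace2 (2 * a * w.1 + c * w.2 - σ w.1) (c * w.1 + 2 * b * w.2 - σ w.2)
      (p 0 - p w) (fun h => hcon ⟨sub_eq_zero.1 h.1, sub_eq_zero.1 h.2⟩)
    rw [filter_true_of_mem, card_univ, Fintype.card_prod, hF] at hle
    · have : q ^ 3 < q ^ 2 * q ^ 2 := by
        rw [← pow_add]
        exact Nat.pow_lt_pow_right (by omega) (by norm_num)
      omega
    · intro v _
      have h1 := hdiff v w
      rw [hw.2 v] at h1
      linear_combination -h1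
  have hw3 : ∀ w, (¬ ∀ v, p (v + w) = p v) → #{v | p (v + w) = p v} ≤ q ^ 3 := by
    intro w hw
    by_cases hm : 2 * a * w.1 + c * w.2 - σ w.1 = 0 ∧ c * w.1 + 2 * b * w.2 - σ w.2 = 0
    · have hconst : ∀ v, p (v + w) - p v = p w - p 0 := fun v => by
        rw [hdiff v w, hm.1, hm.2]; simp
      rw [filter_false_of_mem]
      · simp
      · intro v _ hv
        apply hw
        intro v'
        rw [← sub_eq_zero, hconst, ← hconst v, hv, sub_self]
    · refine (card_le_card fun v hv => ?_).trans (htrace2 _ _ (p 0 - p w) hm)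
      rw [mem_filter] at hv ⊢
      refine ⟨mem_univ _, ?_⟩
      have h1 := hdiff v w
      rw [hv.2] at h1
      linear_combination -h1
  let K : Finset F := {x | σ x = x}
  have hK : #K ≤ q := by
    refine le_trans (card_le_card fun x hx => ?_)
      (card_trinomial_roots_le (q := q) (by omega) (-1 : F) 0)
    rw [mem_filter] at hx ⊢
    exact ⟨mem_univ _, by rw [← hσ, hx.2]; ring⟩
  have hpK : ∀ v, p v ∈ K := by
    intro v
    rw [mem_filter]
    refine ⟨mem_univ _, ?_⟩
    rw [hp]
    simp only [map_add, map_sub, map_mul, hσσ]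
    ring
  have hmom := second_moment_periods (q := q)
    (by rw [Fintype.card_prod, hF]; ring) p K hpK (by simp [K]) hK hw3
  obtain ⟨hRle, hplane⟩ :=
    semilinear_fixed_plane (q := q) (by omega) σ hσ (2 * a) c c (2 * b) R hRmem
  change ((q : ℤ) ^ 4 - #{v | p v = 0}) ^ 2 ≤
      (q - 1) * (q ^ 7 + (#R : ℤ) * ((q : ℤ) ^ 4 - q ^ 3) - (#{v | p v = 0} : ℤ) ^ 2) at hmom
  have hq' : (3 : ℤ) ≤ q := by exact_mod_cast hq
  have hpos : (0 : ℤ) < (q : ℤ) ^ 3 * (q - 1) := by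
    have : (0 : ℤ) < (q : ℤ) - 1 := by linarith
    positivity
  constructor
  · intro h0
    rw [h0] at hmom
    have hR' : (#R : ℤ) ≤ (q : ℤ) ^ 2 := by exact_mod_cast hRle
    have h1 : (#R : ℤ) * ((q : ℤ) ^ 3 * (q - 1)) ≤ (q : ℤ) ^ 2 * ((q : ℤ) ^ 3 * (q - 1)) :=
      mul_le_mul_of_nonneg_right hR' hpos.le
    have h2 := mul_le_mul_of_nonneg_left h1 (by linarith : (0 : ℤ) ≤ (q : ℤ) - 1)
    have h3 : (q : ℤ) ^ 5 * (2 * q - 1) ≤ 0 := by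
      push_cast at hmom
      nlinarith
    have h4 : (0 : ℤ) < (q : ℤ) ^ 5 * (2 * q - 1) := by
      have : (0 : ℤ) < 2 * (q : ℤ) - 1 := by linarith
      positivity
    linarith
  · intro hN
    rw [hN] at hmom
    have hRge : q ^ 2 ≤ #R := by
      have h1 : (q : ℤ) ^ 2 * ((q : ℤ) ^ 3 * (q - 1) * (q - 1)) ≤
          #R * ((q : ℤ) ^ 3 * (q - 1) * (q - 1)) := by
        push_cast at hmom
        nlinarith
      have h2 : (q : ℤ) ^ 2 ≤ #R :=
        le_of_mul_le_mul_right h1 (mul_pos hpos (by linarith))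
      exact_mod_cast h2
    obtain ⟨u₁, _, u₂, _, hD, hspan⟩ := hplane hRge
    have hne : ({v | p v = 0} : Finset (F × F)).Nonempty := by
      rw [← card_pos, hN]
      positivity
    obtain ⟨o, ho⟩ := hne
    rw [mem_filter] at ho
    have hcoset : R.image (fun w => o + w) = ({v | p v = 0} : Finset (F × F)) := by
      apply eq_of_subset_of_card_le
      · intro v hv
        obtain ⟨w, hw, rfl⟩ := mem_image.1 hv
        rw [mem_filter] at hw ⊢
        exact ⟨mem_univ _, (hw.2 o).trans ho.2⟩
      · rw [hN, card_image_of_injective _ (add_right_injective o)]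
        exact hRge
    refine ⟨o, u₁, u₂, hD, fun v hv => ?_⟩
    have hv' : v ∈ R.image (fun w => o + w) := by
      rw [hcoset, mem_filter]
      exact ⟨mem_univ _, hv⟩
    obtain ⟨w, hw, rfl⟩ := mem_image.1 hv'
    obtain ⟨s, t, hs, ht, e1, e2⟩ := hspan w hw
    exact ⟨w, s, t, rfl, hs, ht, e1, e2, (hRmem w hw).1, (hRmem w hw).2⟩

theorem hermPt_smul_s16 {q : ℕ} {F : Type} [Field F] {v : Fin 4 → F} (k : F) (h : hermPt q v) :
    hermPt q (k • v) := by
  simp only [hermPt, Pi.smul_apply, smul_eq_mul, mul_pow] at h ⊢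
  linear_combination k ^ (q + 1) * h

theorem quadPt_smul {F : Type} [Field F] {a b c d e f : F} {v : Fin 4 → F} (k : F)
    (h : quadPt a b c d e f v) : quadPt a b c d e f (k • v) := by
  simp only [quadPt, Pi.smul_apply, smul_eq_mul] at h ⊢
  linear_combination k ^ 2 * h

theorem rep_mk_mem {q : ℕ} {F : Type} [Field F] {a b c d e f : F} {v : Fin 4 → F} (hv : v ≠ 0)
    (h : hermPt q v ∧ quadPt a b c d e f v) :
    hermPt q (Projectivization.mk F v hv).rep ∧
      quadPt a b c d e f (Projectivization.mk F v hv).rep := by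
  obtain ⟨k, hk⟩ := Projectivization.exists_smul_eq_mk_rep F v hv
  rw [← hk, Units.smul_def]
  exact ⟨hermPt_smul_s16 _ h.1, quadPt_smul _ h.2⟩

/-- A common point of `H` and `Q` off the plane `j = 0` in normalized coordinates. -/
theorem mem_affine_iff {q : ℕ} {F : Type} [Field F] {σ : F →+* F} (hσ : ∀ x, σ x = x ^ q)
    {a b c d e f : F} {x y z : F} :
    hermPt q ![1, x, y, z] ∧ quadPt a b c d e f ![1, x, y, z] ↔
      z = a * x ^ 2 + b * y ^ 2 + c * x * y + d * x + e * y + f ∧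
        z + σ z - x * σ x - y * σ y = 0 := by
  simp only [hermPt, quadPt, Matrix.cons_val, hσ, one_pow, one_mul, mul_one]
  rw [and_comm]
  refine and_congr_right fun _ => ⟨fun h => ?_, fun h => ?_⟩ <;> linear_combination h

theorem exists_normalized_rep {q : ℕ} {F : Type} [Field F] {a b c d e f : F}
    (P : Projectivization F (Fin 4 → F)) (hP : hermPt q P.rep ∧ quadPt a b c d e f P.rep)
    (h0 : P.rep 0 ≠ 0) :
    ∃ (x y z : F) (hv : ![1, x, y, z] ≠ 0), Projectivization.mk F ![1, x, y, z] hv = P ∧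
      hermPt q ![1, x, y, z] ∧ quadPt a b c d e f ![1, x, y, z] := by
  have hv : (P.rep 0)⁻¹ • P.rep =
      ![1, (P.rep 0)⁻¹ * P.rep 1, (P.rep 0)⁻¹ * P.rep 2, (P.rep 0)⁻¹ * P.rep 3] := by
    ext i
    fin_cases i <;> simp [h0]
  refine ⟨(P.rep 0)⁻¹ * P.rep 1, (P.rep 0)⁻¹ * P.rep 2, (P.rep 0)⁻¹ * P.rep 3,
    fun h => by simpa using congrFun h 0, ?_, ?_⟩
  · conv_rhs => rw [← P.mk_rep]
    rw [Projectivization.mk_eq_mk_iff']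
    exact ⟨(P.rep 0)⁻¹, hv⟩
  · rw [← hv]
    exact ⟨hermPt_smul_s16 _ hP.1, quadPt_smul _ hP.2⟩

/-- If `H ∩ Q` has `q ^ 2 + 1` points, one of them off the plane `j = 0`, then `[0:0:0:1]` is its
only point on that plane. -/
theorem eq_vertex_of_rep_zero_eq_zero {q : ℕ} {F : Type} [Field F] [Fintype F]
    (hF : Fintype.card F = q ^ 2) {a b c d e f : F}
    (hcard : Nat.card {P : Projectivization F (Fin 4 → F) //
        hermPt q P.rep ∧ quadPt a b c d e f P.rep} = q ^ 2 + 1) (hq : q ≠ 0)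
    {x₀ y₀ z₀ : F} (haff : hermPt q ![1, x₀, y₀, z₀] ∧ quadPt a b c d e f ![1, x₀, y₀, z₀])
    (P : Projectivization F (Fin 4 → F)) (hP : hermPt q P.rep ∧ quadPt a b c d e f P.rep)
    (h0 : P.rep 0 = 0) : P.rep 1 = 0 ∧ P.rep 2 = 0 := by
  by_contra hne
  have hline : ∀ z, (![0, P.rep 1, P.rep 2, z] : Fin 4 → F) ≠ 0 := fun z h =>
    hne ⟨by simpa using congrFun h 1, by simpa using congrFun h 2⟩
  have hline_mem : ∀ z, hermPt q ![0, P.rep 1, P.rep 2, z] ∧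
      quadPt a b c d e f ![0, P.rep 1, P.rep 2, z] := by
    intro z
    have h1 := hP.1
    have h2 := hP.2
    simp only [hermPt, quadPt, h0, Matrix.cons_val] at h1 h2 ⊢
    simp only [zero_pow hq, zero_mul, zero_add] at h1 h2 ⊢
    exact ⟨h1, h2⟩
  have hvertex : (![0, 0, 0, 1] : Fin 4 → F) ≠ 0 := fun h => by simpa using congrFun h 3
  have haff0 : (![1, x₀, y₀, z₀] : Fin 4 → F) ≠ 0 := fun h => by simpa using congrFun h 0
  have hvertex_mem : hermPt q ![(0 : F), 0, 0, 1] ∧ quadPt a b c d e f ![0, 0, 0, 1] := by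
    simp [hermPt, quadPt, hq]
  let φ : Option (Option F) → {P : Projectivization F (Fin 4 → F) //
      hermPt q P.rep ∧ quadPt a b c d e f P.rep}
    | none => ⟨_, rep_mk_mem haff0 haff⟩
    | some none => ⟨_, rep_mk_mem hvertex hvertex_mem⟩
    | some (some z) => ⟨_, rep_mk_mem (hline z) (hline_mem z)⟩
  have hφ : Function.Injective φ := by
    rintro (_ | _ | z) (_ | _ | z') h <;> first | rfl | skip
    all_goals
      have h' := congrArg Subtype.val h
      simp only [φ] at h'
      rw [Projectivization.mk_eq_mk_iff'] at h'
      obtain ⟨k, hk⟩ := h'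
      have k0 := congrFun hk 0
      have k1 := congrFun hk 1
      have k2 := congrFun hk 2
      have k3 := congrFun hk 3
      simp only [Pi.smul_apply, smul_eq_mul, Matrix.cons_val, mul_zero, mul_one] at k0 k1 k2 k3
    · exact absurd k0 zero_ne_one
    · exact absurd k0 zero_ne_one
    · subst k0; simp at k3
    · have hk0 : k ≠ 0 := left_ne_zero_of_mul_eq_one k3
      exact absurd ⟨(mul_eq_zero.1 k1).resolve_left hk0, (mul_eq_zero.1 k2).resolve_left hk0⟩ hne
    · subst k0
      exact absurd ⟨by simpa using k1.symm, by simpa using k2.symm⟩ hne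
    · exact absurd ⟨k1.symm, k2.symm⟩ hne
    · have hk1 : k = 1 := by
        by_contra hk1
        have : k - 1 ≠ 0 := sub_ne_zero.2 hk1
        refine hne ⟨?_, ?_⟩
        · exact (mul_eq_zero.1 (show (k - 1) * P.rep 1 = 0 by linear_combination k1)).resolve_left
            this
        · exact (mul_eq_zero.1 (show (k - 1) * P.rep 2 = 0 by linear_combination k2)).resolve_left
            this
      rw [hk1, one_mul] at k3
      rw [k3]
  have hfin : Finite {P : Projectivization F (Fin 4 → F) //
      hermPt q P.rep ∧ quadPt a b c d e f P.rep} := Nat.finite_of_card_ne_zero (by omega)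
  have := Nat.card_le_card_of_injective φ hφ
  rw [hcard, Nat.card_eq_fintype_card, Fintype.card_option, Fintype.card_option, hF] at this
  omega

/-- If `H ∩ Q` has `q ^ 2 + 1` points and `[0:0:0:1]` is the only one with `j = 0`, then it has
`q ^ 2` points with `j ≠ 0`. -/
theorem card_affine_part {q : ℕ} {F : Type} [Field F] [Fintype F] [DecidableEq F]
    {σ : F →+* F} (hσ : ∀ x, σ x = x ^ q) {a b c d e f : F}
    (hcard : Nat.card {P : Projectivization F (Fin 4 → F) //
        hermPt q P.rep ∧ quadPt a b c d e f P.rep} = q ^ 2 + 1) (hq : q ≠ 0)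
    (Q p : F × F → F)
    (hQ : ∀ v, Q v = a * v.1 ^ 2 + b * v.2 ^ 2 + c * v.1 * v.2 + d * v.1 + e * v.2 + f)
    (hp : ∀ v, p v = Q v + σ (Q v) - v.1 * σ v.1 - v.2 * σ v.2)
    (hinf : ∀ P : Projectivization F (Fin 4 → F),
      hermPt q P.rep ∧ quadPt a b c d e f P.rep → P.rep 0 = 0 → P.rep 1 = 0 ∧ P.rep 2 = 0) :
    Finset.card {v | p v = 0} = q ^ 2 := by
  have hvertex : (![0, 0, 0, 1] : Fin 4 → F) ≠ 0 := fun h => by simpa using congrFun h 3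
  have hvertex_mem : hermPt q ![(0 : F), 0, 0, 1] ∧ quadPt a b c d e f ![0, 0, 0, 1] := by
    simp [hermPt, quadPt, hq]
  have haff : ∀ v : F × F, (![1, v.1, v.2, Q v] : Fin 4 → F) ≠ 0 := fun v h => by
    simpa using congrFun h 0
  have haff_mem : ∀ v : {v // p v = 0}, hermPt q ![1, v.1.1, v.1.2, Q v] ∧
      quadPt a b c d e f ![1, v.1.1, v.1.2, Q v] := fun v =>
    (mem_affine_iff hσ).2 ⟨hQ v, by rw [← hp]; exact v.2⟩
  let φ : Option {v // p v = 0} → {P : Projectivization F (Fin 4 → F) //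
      hermPt q P.rep ∧ quadPt a b c d e f P.rep}
    | none => ⟨_, rep_mk_mem hvertex hvertex_mem⟩
    | some v => ⟨_, rep_mk_mem (haff v) (haff_mem v)⟩
  have hφ : Function.Bijective φ := by
    constructor
    · rintro (_ | v) (_ | w) h <;> first | rfl | skip
      all_goals
        have h' := congrArg Subtype.val h
        simp only [φ] at h'
        rw [Projectivization.mk_eq_mk_iff'] at h'
        obtain ⟨k, hk⟩ := h'
        have k0 := congrFun hk 0
        have k1 := congrFun hk 1
        have k2 := congrFun hk 2
        have k3 := congrFun hk 3
        simp only [Pi.smul_apply, smul_eq_mul, Matrix.cons_val, mul_zero, mul_one] at k0 k1 k2 k3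
      · subst k0; simp at k3
      · exact absurd k0 zero_ne_one
      · rw [k0, one_mul] at k1 k2
        rw [Subtype.ext (Prod.ext k1.symm k2.symm)]
    · rintro ⟨P, hP⟩
      by_cases h0 : P.rep 0 = 0
      · obtain ⟨h1, h2⟩ := hinf P hP h0
        refine ⟨none, Subtype.ext ?_⟩
        simp only [φ]
        conv_rhs => rw [← P.mk_rep]
        rw [Projectivization.mk_eq_mk_iff']
        have h3 : P.rep 3 ≠ 0 := fun h3 => P.rep_nonzero <| by
          ext i
          fin_cases i <;> simp [h0, h1, h2, h3]
        refine ⟨(P.rep 3)⁻¹, ?_⟩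
        ext i
        fin_cases i <;> simp [h0, h1, h2, h3]
      · obtain ⟨x, y, z, hv, rfl, hmem⟩ := exists_normalized_rep P hP h0
        obtain ⟨hz, hzero⟩ := (mem_affine_iff hσ).1 hmem
        have hzQ : z = Q (x, y) := hz.trans (hQ (x, y)).symm
        subst hzQ
        exact ⟨some ⟨(x, y), by rw [hp]; exact hzero⟩, rfl⟩
  have h := Nat.card_eq_of_bijective φ hφ
  rw [hcard, Nat.card_eq_fintype_card, Fintype.card_option, Fintype.card_subtype] at h
  omega

/-- The frame of `F⁴` with origin over `o`, directions over `u₁`, `u₂`, and heights `k`, `l₁`, `l₂`. -/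
theorem exists_affine_frame {F : Type*} [Field F] (o u₁ u₂ : F × F)
    (hD : u₁.1 * u₂.2 - u₁.2 * u₂.1 ≠ 0) (k l₁ l₂ : F) :
    ∃ g : (Fin 4 → F) ≃ₗ[F] (Fin 4 → F), ∀ j s t r : F,
      g ![j, j * o.1 + (s * u₁.1 + t * u₂.1), j * o.2 + (s * u₁.2 + t * u₂.2),
        r + j * k + s * l₁ + t * l₂] = ![j, s, t, r] := by
  let h : (Fin 4 → F) →ₗ[F] (Fin 4 → F) :=
    { toFun := fun v => ![v 0, v 0 * o.1 + (v 1 * u₁.1 + v 2 * u₂.1),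
        v 0 * o.2 + (v 1 * u₁.2 + v 2 * u₂.2), v 3 + v 0 * k + v 1 * l₁ + v 2 * l₂]
      map_add' := fun v w => by
        ext i
        fin_cases i <;> simp <;> ring
      map_smul' := fun k v => by
        ext i
        fin_cases i <;> simp <;> ring }
  have hinj : Function.Injective h := by
    rw [← LinearMap.ker_eq_bot, LinearMap.ker_eq_bot']
    intro v hv
    have k0 : v 0 = 0 := by simpa [h] using congrFun hv 0
    have k1 : v 1 * u₁.1 + v 2 * u₂.1 = 0 := by simpa [h, k0] using congrFun hv 1
    have k2 : v 1 * u₁.2 + v 2 * u₂.2 = 0 := by simpa [h, k0] using congrFun hv 2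
    have v1 : v 1 = 0 := (mul_eq_zero.1 (show v 1 * (u₁.1 * u₂.2 - u₁.2 * u₂.1) = 0 by
      linear_combination k1 * u₂.2 - k2 * u₂.1)).resolve_right hD
    have v2 : v 2 = 0 := (mul_eq_zero.1 (show v 2 * (u₁.1 * u₂.2 - u₁.2 * u₂.1) = 0 by
      linear_combination k2 * u₁.1 - k1 * u₁.2)).resolve_right hD
    have v3 : v 3 = 0 := by simpa [h, k0, v1, v2] using congrFun hv 3
    ext i
    fin_cases i <;> simp [k0, v1, v2, v3]
  refine ⟨(LinearEquiv.ofInjectiveEndo h hinj).symm, fun j s t r => ?_⟩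
  rw [LinearEquiv.symm_apply_eq]
  ext i
  fin_cases i <;> simp [h]

theorem minimal_intersection_in_baer_subgeometry
    (q : ℕ) (hq : ∃ p n : ℕ, p.Prime ∧ Odd p ∧ 0 < n ∧ q = p ^ n)
    (F : Type) [Field F] [Fintype F] (hF : Fintype.card F = q ^ 2)
    (a b c d e f : F) (habc : ¬ (a = 0 ∧ b = 0 ∧ c = 0))
    (hcard : Nat.card {P : Projectivization F (Fin 4 → F) //
        hermPt q P.rep ∧ quadPt a b c d e f P.rep} = q ^ 2 + 1) :
    ∃ g : (Fin 4 → F) ≃ₗ[F] (Fin 4 → F),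
      ∀ P : Projectivization F (Fin 4 → F),
        hermPt q P.rep ∧ quadPt a b c d e f P.rep →
        ∃ (v : Fin 4 → F) (hv : v ≠ 0),
          Projectivization.mk F v hv = P ∧ ∀ i : Fin 4, (g v i) ^ q = g v i := by
  classical
  obtain ⟨ℓ, n, hℓ, hodd, hn, rfl⟩ := hq
  have : Fact ℓ.Prime := ⟨hℓ⟩
  have : CharP F ℓ := charP_of_card_eq_prime_pow (f := n * 2) (by rw [hF, pow_mul])
  have hℓ3 : 3 ≤ ℓ := by
    have := hℓ.two_le
    have : ℓ ≠ 2 := by rintro rfl; exact absurd hodd (by decide)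
    omega
  have hq3 : 3 ≤ ℓ ^ n := hℓ3.trans (Nat.le_self_pow hn.ne' ℓ)
  have h2 : (2 : F) ≠ 0 := Ring.two_ne_zero (by rw [ringChar.eq F ℓ]; omega)
  let σ : F →+* F := iterateFrobenius F ℓ n
  have hσ : ∀ x, σ x = x ^ ℓ ^ n := fun x => iterateFrobenius_def ℓ n x
  generalize ℓ ^ n = q at *
  have hσσ : ∀ x, σ (σ x) = x := fun x => by
    rw [hσ, hσ, ← pow_mul, ← sq, ← hF, FiniteField.pow_card]
  have hq0 : q ≠ 0 := by omega
  let Q : F × F → F := fun v =>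
    a * v.1 ^ 2 + b * v.2 ^ 2 + c * v.1 * v.2 + d * v.1 + e * v.2 + f
  let p : F × F → F := fun v => Q v + σ (Q v) - v.1 * σ v.1 - v.2 * σ v.2
  obtain ⟨hN0, hN⟩ := hermitian_quadric_affine_part hq3 hF σ hσ a b c d e f Q p
    (fun _ => rfl) (fun _ => rfl)
  obtain ⟨v₀, hv₀⟩ := Finset.card_ne_zero.1 hN0
  rw [Finset.mem_filter] at hv₀
  have hinf := eq_vertex_of_rep_zero_eq_zero hF hcard hq0
    ((mem_affine_iff (x := v₀.1) (y := v₀.2) hσ).2 ⟨rfl, hv₀.2⟩)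
  obtain ⟨o, u₁, u₂, hD, hcoset⟩ := hN (card_affine_part hσ hcard hq0 Q p (fun _ => rfl)
    (fun _ => rfl) hinf)
  let L : F × F → F := fun w =>
    2 * a * o.1 * w.1 + 2 * b * o.2 * w.2 + c * (o.1 * w.2 + o.2 * w.1) + d * w.1 + e * w.2
  obtain ⟨g, hg⟩ := exists_affine_frame o u₁ u₂ hD (Q o) (L u₁) (L u₂)
  refine ⟨g, fun P hP => ?_⟩
  by_cases h0 : P.rep 0 = 0
  · obtain ⟨h1, h2⟩ := hinf P hP h0
    have h3 : P.rep 3 ≠ 0 := fun h3 => P.rep_nonzero <| by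
      ext i
      fin_cases i <;> simp [h0, h1, h2, h3]
    refine ⟨![0, 0, 0, 1], fun hv => by simpa using congrFun hv 3, ?_, ?_⟩
    · conv_rhs => rw [← P.mk_rep]
      rw [Projectivization.mk_eq_mk_iff']
      refine ⟨(P.rep 3)⁻¹, ?_⟩
      ext i
      fin_cases i <;> simp [h0, h1, h2, h3]
    · have hvertex : g ![0, 0, 0, 1] = ![0, 0, 0, 1] := by simpa using hg 0 0 0 1
      rw [hvertex]
      intro i
      fin_cases i <;> simp [hq0]
  · obtain ⟨x, y, z, hv, hPv, hmem⟩ := exists_normalized_rep P hP h0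
    obtain ⟨hz, hzero⟩ := (mem_affine_iff hσ).1 hmem
    have hzQ : z = Q (x, y) := hz
    have hxy0 : p (x, y) = 0 := by rw [hzQ] at hzero; exact hzero
    obtain ⟨w, s, t, hxy, hs, ht, e1, e2, r1, r2⟩ := hcoset (x, y) hxy0
    have hx : x = o.1 + w.1 := congrArg Prod.fst hxy
    have hy : y = o.2 + w.2 := congrArg Prod.snd hxy
    let r : F := (w.1 * σ w.1 + w.2 * σ w.2) / 2
    have hr : σ r = r := by
      simp only [r, map_div₀, map_add, map_mul, hσσ, map_ofNat]
      ring
    have hrQ : r = a * w.1 ^ 2 + b * w.2 ^ 2 + c * w.1 * w.2 := by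
      simp only [r]
      rw [← r1, ← r2]
      field_simp
      ring
    have hL : L w = s * L u₁ + t * L u₂ := by
      simp only [L, e1, e2]
      ring
    have hzL : z = r + 1 * Q o + s * L u₁ + t * L u₂ := by
      rw [add_assoc, ← hL, hz, hrQ, hx, hy]
      simp only [Q, L]
      ring
    have hgv : g ![1, x, y, z] = ![1, s, t, r] := by
      rw [← hg 1 s t r, ← hzL, one_mul, one_mul, ← e1, ← e2, ← hx, ← hy]
    refine ⟨![1, x, y, z], hv, hPv, fun i => ?_⟩
    rw [hgv, ← hσ]
    fin_cases i <;> simp [hs, ht, hr]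
end
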